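/- arXiv:1512.08191 — 7 statements merged into one kernel-verified Lean document; each statement's English description precedes it below -/
import Mathlib

section
/- Let Y = μ + Z where Z is a zero-mean random vector in ℝ^d with covariance matrix σ²·I_d, and let μ̂ : ℝ^d → ℝ^d be a measurable map such that all expectations below are finite. Then the mean squared error satisfies E‖μ − μ̂(Y)‖² = E‖Y − μ̂(Y)‖² − d·σ² + 2·tr Cov(Y, μ̂(Y)), where Cov(Y, μ̂(Y)) = E[(Y − E[Y])(μ̂(Y) − E[μ̂(Y)])ᵀ] is the cross-covariance matrix. -/
open MeasureTheory

/-- If a finite sum of squares of measurable functions is integrable, every function is in `L²`. -/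
lemma memLp_two_of_integrable_sum_sq {Ω ι : Type*} [MeasurableSpace Ω] [Fintype ι]
    {P : Measure Ω} {f : ι → Ω → ℝ} (hf : ∀ i, Measurable (f i))
    (hint : Integrable (fun ω => ∑ i, f i ω ^ 2) P) (i : ι) : MemLp (f i) 2 P := by
  refine (memLp_two_iff_integrable_sq (hf i).aestronglyMeasurable).2
    (hint.mono' ((hf i).pow_const 2).aestronglyMeasurable (.of_forall fun ω => ?_))
  rw [Real.norm_of_nonneg (sq_nonneg _)]
  exact Finset.single_le_sum (f := fun j => f j ω ^ 2) (fun j _ => sq_nonneg _)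
    (Finset.mem_univ i)

/-- MSE decomposition for additive zero-mean noise with covariance `σ² I_d`:
`E‖μ − μ̂(Y)‖² = E‖Y − μ̂(Y)‖² − d σ² + 2 tr Cov(Y, μ̂(Y))`. -/
theorem mse_decomposition
    {Ω : Type*} [MeasurableSpace Ω] (P : Measure Ω) [IsProbabilityMeasure P]
    (d : ℕ) (μ : Fin d → ℝ) (σ : ℝ) (Z : Ω → Fin d → ℝ)
    (hatμ : (Fin d → ℝ) → (Fin d → ℝ))
    (Y : Ω → Fin d → ℝ) (hY : ∀ ω, Y ω = μ + Z ω)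
    (hmeas : Measurable Y) (hmeashat : Measurable hatμ)
    (hZmean : ∀ i, ∫ ω, Z ω i ∂P = 0)
    (hZcov : ∀ i j, ∫ ω, Z ω i * Z ω j ∂P = if i = j then σ ^ 2 else 0)
    (hint1 : Integrable (fun ω => ∑ i, (μ i - hatμ (Y ω) i) ^ 2) P)
    (hint2 : Integrable (fun ω => ∑ i, (Y ω i - hatμ (Y ω) i) ^ 2) P)
    (hint3 : ∀ i, Integrable (fun ω => hatμ (Y ω) i) P)
    (hint4 : ∀ i, Integrable
      (fun ω => (Y ω i - ∫ ω', Y ω' i ∂P) * (hatμ (Y ω) i - ∫ ω', hatμ (Y ω') i ∂P)) P) :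
    ∫ ω, ∑ i, (μ i - hatμ (Y ω) i) ^ 2 ∂P
      = (∫ ω, ∑ i, (Y ω i - hatμ (Y ω) i) ^ 2 ∂P) - d * σ ^ 2
        + 2 * ∑ i, ∫ ω,
            (Y ω i - ∫ ω', Y ω' i ∂P) * (hatμ (Y ω) i - ∫ ω', hatμ (Y ω') i ∂P) ∂P := by
  have hYi (i) : Measurable fun ω => Y ω i := (measurable_pi_apply i).comp hmeas
  have hHi (i) : Measurable fun ω => hatμ (Y ω) i :=
    (measurable_pi_apply i).comp (hmeashat.comp hmeas)
  have ha := memLp_two_of_integrable_sum_sq (f := fun i ω => μ i - hatμ (Y ω) i)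
    (fun i => (hHi i).const_sub _) hint1
  have hb := memLp_two_of_integrable_sum_sq (f := fun i ω => Y ω i - hatμ (Y ω) i)
    (fun i => (hYi i).sub (hHi i)) hint2
  have hz (i) : MemLp (fun ω => Z ω i) 2 P := by
    convert (hb i).sub (ha i) using 1
    ext ω
    simp [hY]
  have hzint (i) : Integrable (fun ω => Z ω i) P := (hz i).integrable one_le_two
  have hYmean (i) : ∫ ω, Y ω i ∂P = μ i := by
    simp [hY, integral_add (integrable_const _) (hzint i), hZmean]
  have key (i) : ∫ ω, (μ i - hatμ (Y ω) i) ^ 2 ∂P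
      = ∫ ω, (Y ω i - hatμ (Y ω) i) ^ 2 ∂P - σ ^ 2 + 2 * ∫ ω,
        (Y ω i - ∫ ω', Y ω' i ∂P) * (hatμ (Y ω) i - ∫ ω', hatμ (Y ω') i ∂P) ∂P := by
    have hcov := hint4 i
    have hzz : Integrable (fun ω => Z ω i * Z ω i) P := (hz i).integrable_mul (hz i)
    have hbb := (hb i).integrable_sq
    rw [hYmean i] at hcov ⊢
    set c := ∫ ω', hatμ (Y ω') i ∂P
    have hpt (ω) : (μ i - hatμ (Y ω) i) ^ 2 = (Y ω i - hatμ (Y ω) i) ^ 2 - Z ω i * Z ω i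
        + 2 * ((Y ω i - μ i) * (hatμ (Y ω) i - c)) + 2 * (c - μ i) * Z ω i := by
      simp only [hY ω, Pi.add_apply]
      ring
    rw [integral_congr_ae (.of_forall hpt),
      integral_add (by exact (hbb.sub hzz).add (hcov.const_mul 2)) ((hzint i).const_mul _),
      integral_add (by exact hbb.sub hzz) (hcov.const_mul 2),
      integral_sub hbb hzz, integral_const_mul, integral_const_mul,
      hZmean, hZcov, if_pos rfl, mul_zero, add_zero]
  rw [integral_finsetSum _ fun i _ => (ha i).integrable_sq,
    integral_finsetSum _ fun i _ => (hb i).integrable_sq, Finset.sum_congr rfl fun i _ => key i,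
    Finset.sum_add_distrib, Finset.sum_sub_distrib, Finset.mul_sum]
  simp
end

section
/- (Unbiasedness of SURE) Let Y ∼ N(μ, σ²·I_d) be a Gaussian random vector in ℝ^d and let μ̂ : ℝ^d → ℝ^d be continuously differentiable with bounded partial derivatives. Define SURE(Y) = ‖Y − μ̂(Y)‖² − d·σ² + 2σ²·tr(∂μ̂/∂y)(Y). Then E[SURE(Y)] = E‖μ − μ̂(Y)‖². -/
open MeasureTheory ProbabilityTheory

theorem LipschitzWith.memLp_of_memLp_id {E F : Type*} [NormedAddCommGroup E] [MeasurableSpace E]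
    [NormedAddCommGroup F] {ρ : Measure E} [IsFiniteMeasure ρ] {p : ENNReal}
    (hρ : MemLp id p ρ) {K : NNReal} {g : E → F} (hg : LipschitzWith K g) : MemLp g p ρ := by
  have h0 : LipschitzWith K (fun x ↦ g x - g 0) := by
    simpa using hg.sub (LipschitzWith.const (g 0))
  have h1 : MemLp (fun x ↦ g x - g 0) p ρ := h0.comp_memLp (by simp) hρ
  convert h1.add (memLp_const (g 0)) using 1
  ext x
  simp

theorem LipschitzWith.integrable_deriv {ρ : Measure ℝ} [IsFiniteMeasure ρ]
    {K : NNReal} {g : ℝ → ℝ} (hg : LipschitzWith K g) : Integrable (deriv g) ρ :=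
  .of_bound (measurable_deriv g).aestronglyMeasurable K
    (.of_forall fun _ ↦ norm_deriv_le_of_lipschitz hg)

theorem integrable_gaussianReal_iff {m : ℝ} {v : NNReal} (hv : v ≠ 0) {f : ℝ → ℝ} :
    Integrable f (gaussianReal m v) ↔ Integrable (fun x ↦ gaussianPDFReal m v x * f x) := by
  rw [gaussianReal_of_var_ne_zero m hv,
    integrable_withDensity_iff_integrable_smul' (measurable_gaussianPDF m v)
      (.of_forall fun _ ↦ gaussianPDF_lt_top)]
  simp

theorem hasDerivAt_gaussianPDFReal (m : ℝ) {v : NNReal} (hv : v ≠ 0) (x : ℝ) :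
    HasDerivAt (gaussianPDFReal m v) (-((x - m) / v * gaussianPDFReal m v x)) x := by
  have hv' : (v : ℝ) ≠ 0 := by exact_mod_cast hv
  have h := (((((hasDerivAt_id x).sub_const m).pow 2).neg.div_const (2 * (v : ℝ))).exp).const_mul
    (√(2 * Real.pi * v))⁻¹
  refine h.congr_deriv ?_
  simp only [gaussianPDFReal, id, Pi.pow_apply, Pi.neg_apply]
  simp
  field_simp

theorem integral_sub_mul_gaussianReal {m : ℝ} {v K : NNReal} {g : ℝ → ℝ}
    (hd : Differentiable ℝ g) (hg : LipschitzWith K g) :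
    ∫ x, (x - m) * g x ∂gaussianReal m v = v * ∫ x, deriv g x ∂gaussianReal m v := by
  rcases eq_or_ne v 0 with rfl | hv
  · simp
  have hv' : (v : ℝ) ≠ 0 := by exact_mod_cast hv
  have hid : MemLp id 2 (gaussianReal m v) := memLp_id_gaussianReal' 2 (by simp)
  have hg2 := hg.memLp_of_memLp_id hid
  have hsub : MemLp (fun x ↦ x - m) 2 (gaussianReal m v) := hid.sub (memLp_const m)
  have i1 := (integrable_gaussianReal_iff hv).1 (hsub.integrable_mul hg2)
  have i2 := (integrable_gaussianReal_iff hv).1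
    (hg.integrable_deriv (ρ := gaussianReal m v))
  have i3 := (integrable_gaussianReal_iff hv).1 (hg2.integrable (by simp))
  have key := integral_mul_deriv_eq_deriv_mul_of_integrable (u := g) (v := gaussianPDFReal m v)
    (fun x _ ↦ (hd x).hasDerivAt) (fun x _ ↦ hasDerivAt_gaussianPDFReal m hv x)
    ((i1.const_mul (-(v : ℝ)⁻¹)).congr (.of_forall fun x ↦ by simp; field_simp))
    (i2.congr (.of_forall fun x ↦ by simp [mul_comm]))
    (i3.congr (.of_forall fun x ↦ by simp [mul_comm]))
  rw [integral_gaussianReal_eq_integral_smul hv, integral_gaussianReal_eq_integral_smul hv]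
  simp only [smul_eq_mul]
  calc ∫ x, gaussianPDFReal m v x * ((x - m) * g x)
      = ∫ x, -(v : ℝ) * (g x * -((x - m) / v * gaussianPDFReal m v x)) := by
        congr with x; field_simp
    _ = v * ∫ x, gaussianPDFReal m v x * deriv g x := by
        rw [integral_const_mul, key]; simp [mul_comm]

theorem memLp_id_pi_gaussianReal {ι : Type*} [Fintype ι] (m : ι → ℝ) (v : ι → NNReal) :
    MemLp id 2 (Measure.pi fun i ↦ gaussianReal (m i) (v i)) :=
  MemLp.of_eval fun i ↦ (memLp_id_gaussianReal' 2 (by simp)).comp_measurePreserving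
    (measurePreserving_eval (fun i ↦ gaussianReal (m i) (v i)) i)

theorem LipschitzWith.integrable_fderiv_apply {E : Type*} [NormedAddCommGroup E] [NormedSpace ℝ E]
    [MeasurableSpace E] [OpensMeasurableSpace E] {ρ : Measure E}
    [IsFiniteMeasure ρ] {K : NNReal} {g : E → ℝ} (hg : LipschitzWith K g) (w : E) :
    Integrable (fun y ↦ fderiv ℝ g y w) ρ :=
  .of_bound (measurable_fderiv_apply_const ℝ g w).aestronglyMeasurable (K * ‖w‖)
    (.of_forall fun _ ↦ ContinuousLinearMap.le_of_opNorm_le _ (norm_fderiv_le_of_lipschitz ℝ hg) w)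

theorem Fin.lipschitzWith_insertNth {n : ℕ} (i : Fin (n + 1)) (z : Fin n → ℝ) :
    LipschitzWith 1 fun t : ℝ ↦ i.insertNth (α := fun _ ↦ ℝ) t z :=
  .of_dist_le_mul fun s t ↦ by
    rw [NNReal.coe_one, one_mul, dist_pi_le_iff dist_nonneg, i.forall_iff_succAbove]
    simp

theorem Fin.hasDerivAt_insertNth {n : ℕ} (i : Fin (n + 1)) (z : Fin n → ℝ) (t : ℝ) :
    HasDerivAt (fun t : ℝ ↦ i.insertNth (α := fun _ ↦ ℝ) t z) (Pi.single i 1) t := by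
  rw [hasDerivAt_pi, i.forall_iff_succAbove]
  simpa using ⟨hasDerivAt_id' t, fun j ↦ hasDerivAt_const t (z j)⟩

theorem integral_sub_mul_pi_gaussianReal {d : ℕ} (m : Fin d → ℝ) (v : Fin d → NNReal)
    {K : NNReal} {g : (Fin d → ℝ) → ℝ} (hd : Differentiable ℝ g) (hg : LipschitzWith K g)
    (i : Fin d) :
    ∫ y, (y i - m i) * g y ∂Measure.pi (fun i ↦ gaussianReal (m i) (v i))
      = v i * ∫ y, fderiv ℝ g y (Pi.single i 1) ∂Measure.pi (fun i ↦ gaussianReal (m i) (v i)) := by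
  obtain _ | n := d
  · exact i.elim0
  set γ := Measure.pi fun i ↦ gaussianReal (m i) (v i) with hγ
  have hid : MemLp id 2 γ := memLp_id_pi_gaussianReal m v
  have i1 : Integrable (fun y ↦ (y i - m i) * g y) γ :=
    ((hid.eval i).sub (memLp_const (m i))).integrable_mul (hg.memLp_of_memLp_id hid)
  have i2 := hg.integrable_fderiv_apply (ρ := γ) (Pi.single i 1)
  have hmp := (measurePreserving_piFinSuccAbove (fun i ↦ gaussianReal (m i) (v i)) i).symm
  rw [← hγ] at hmp
  have j1 := hmp.integrable_comp_of_integrable i1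
  have j2 := hmp.integrable_comp_of_integrable i2
  simp only [Function.comp_def] at j1 j2
  rw [← hmp.integral_comp', ← hmp.integral_comp', integral_prod_symm _ j1,
    integral_prod_symm _ j2, ← integral_const_mul]
  congr with z
  have hderiv (t : ℝ) : HasDerivAt (fun t : ℝ ↦ g (i.insertNth (α := fun _ ↦ ℝ) t z))
      (fderiv ℝ g (i.insertNth (α := fun _ ↦ ℝ) t z) (Pi.single i 1)) t :=
    (hd _).hasFDerivAt.comp_hasDerivAt t (i.hasDerivAt_insertNth z t)
  have h := integral_sub_mul_gaussianReal (m := m i) (v := v i)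
    (fun t ↦ (hderiv t).differentiableAt) (hg.comp (i.lipschitzWith_insertNth z))
  simp only [(hderiv _).deriv] at h
  have hsymm (t : ℝ) : (MeasurableEquiv.piFinSuccAbove (fun _ ↦ ℝ) i).symm (t, z)
      = i.insertNth (α := fun _ ↦ ℝ) t z := rfl
  simpa [hsymm] using h

theorem exists_lipschitzWith_of_abs_fderiv_single_le {ι : Type*} [Fintype ι] [DecidableEq ι]
    {g : (ι → ℝ) → ℝ} (hd : Differentiable ℝ g) {C : ℝ}
    (hC : ∀ y j, |fderiv ℝ g y (Pi.single j 1)| ≤ C) : ∃ K, LipschitzWith K g := by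
  refine ⟨Fintype.card ι * C.toNNReal, lipschitzWith_of_nnnorm_fderiv_le hd fun y ↦ ?_⟩
  refine ContinuousLinearMap.opNorm_le_bound _ (NNReal.coe_nonneg _) fun w ↦ ?_
  calc ‖fderiv ℝ g y w‖
      = ‖∑ j, w j * fderiv ℝ g y (Pi.single j 1)‖ := by
        conv_lhs => rw [pi_eq_sum_univ' w]
        simp
    _ ≤ ∑ _j : ι, ‖w‖ * (C.toNNReal : ℝ) := by
        refine norm_sum_le_of_le _ fun j _ ↦ ?_
        rw [norm_mul]
        exact mul_le_mul (norm_le_pi_norm w j) ((hC y j).trans (Real.le_coe_toNNReal C))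
          (norm_nonneg _) (norm_nonneg _)
    _ = _ := by simp; ring

theorem integral_sure_eq_pi_gaussianReal {d : ℕ} (m : Fin d → ℝ) (v : NNReal)
    {f : (Fin d → ℝ) → Fin d → ℝ} (hd : ∀ i, Differentiable ℝ fun y ↦ f y i)
    (hf : ∀ i, ∃ K, LipschitzWith K fun y ↦ f y i) :
    ∫ y, ((∑ i, (y i - f y i) ^ 2) - d * (v : ℝ)
        + 2 * v * ∑ i, fderiv ℝ (fun y ↦ f y i) y (Pi.single i 1))
          ∂Measure.pi (fun i ↦ gaussianReal (m i) v)
      = ∫ y, ∑ i, (m i - f y i) ^ 2 ∂Measure.pi (fun i ↦ gaussianReal (m i) v) := by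
  choose K hK using hf
  set γ := Measure.pi fun i ↦ gaussianReal (m i) v with hγ
  have hid : MemLp id 2 γ := memLp_id_pi_gaussianReal m fun _ ↦ v
  have hf2 (i) : MemLp (fun y ↦ f y i) 2 γ := (hK i).memLp_of_memLp_id hid
  have hsub (i) : Integrable (fun y ↦ (m i - f y i) ^ 2) γ :=
    ((memLp_const (m i)).sub (hf2 i)).integrable_sq
  have hres (i) : Integrable (fun y ↦ (y i - f y i) ^ 2) γ :=
    ((hid.eval i).sub (hf2 i)).integrable_sq
  have hdiv (i) : Integrable (fun y ↦ fderiv ℝ (fun y ↦ f y i) y (Pi.single i 1)) γ :=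
    (hK i).integrable_fderiv_apply _
  have stein (i) : ∫ y, (y i - f y i) ^ 2 ∂γ - ∫ y, (m i - f y i) ^ 2 ∂γ
      = v - 2 * v * ∫ y, fderiv ℝ (fun y ↦ f y i) y (Pi.single i 1) ∂γ := by
    have hproj : LipschitzWith 1 fun y : Fin d → ℝ ↦ y i := LipschitzWith.eval i
    have hlip : LipschitzWith _ (fun y ↦ y i + m i - (f y i + f y i)) :=
      (hproj.add (.const (m i))).sub ((hK i).add (hK i))
    have hfd (y) : HasFDerivAt (fun y ↦ y i + m i - (f y i + f y i))
        (ContinuousLinearMap.proj (R := ℝ) (φ := fun _ : Fin d ↦ ℝ) i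
          - (fderiv ℝ (fun y ↦ f y i) y + fderiv ℝ (fun y ↦ f y i) y)) y :=
      ((hasFDerivAt_apply i y).add_const (m i)).sub
        ((hd i y).hasFDerivAt.add (hd i y).hasFDerivAt)
    have h := integral_sub_mul_pi_gaussianReal m (fun _ ↦ v)
      (fun y ↦ (hfd y).differentiableAt) hlip i
    simp only [(hfd _).fderiv, ← hγ] at h
    rw [← integral_sub (hres i) (hsub i)]
    calc ∫ y, ((y i - f y i) ^ 2 - (m i - f y i) ^ 2) ∂γ
        = ∫ y, (y i - m i) * (y i + m i - (f y i + f y i)) ∂γ := by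
          congr with y; ring
      _ = v * ∫ y, (1 - 2 * fderiv ℝ (fun y ↦ f y i) y (Pi.single i 1)) ∂γ := by
          rw [h]; congr with y; simp; ring
      _ = _ := by
          rw [integral_sub (integrable_const _) ((hdiv i).const_mul 2), integral_const_mul]
          simp; ring
  have hres' := integrable_finsetSum Finset.univ fun i _ ↦ hres i
  have hdiv' := integrable_finsetSum Finset.univ fun i _ ↦ hdiv i
  have hres_sub : Integrable (fun y ↦ (∑ i, (y i - f y i) ^ 2) - d * (v : ℝ)) γ :=
    hres'.sub (integrable_const _)
  rw [integral_add hres_sub (hdiv'.const_mul _),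
    integral_sub hres' (integrable_const _), integral_const, integral_const_mul,
    integral_finsetSum _ fun i _ ↦ hres i, integral_finsetSum _ fun i _ ↦ hdiv i,
    integral_finsetSum _ fun i _ ↦ hsub i]
  have hsum := Finset.sum_congr rfl fun i (_ : i ∈ Finset.univ) ↦ stein i
  simp only [Finset.sum_sub_distrib, ← Finset.mul_sum] at hsum
  simp at hsum ⊢
  linarith

/-- Unbiasedness of SURE: if `Y ∼ N(μ, σ² I_d)` and `μ̂` is continuously
differentiable with bounded partial derivatives, then
`E[‖Y − μ̂(Y)‖² − d σ² + 2 σ² tr (∂μ̂/∂y)(Y)] = E‖μ − μ̂(Y)‖²`. -/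
theorem sure_unbiased
    {Ω : Type*} [MeasurableSpace Ω] (P : Measure Ω) [IsProbabilityMeasure P]
    (d : ℕ) (μ : Fin d → ℝ) (σ : NNReal)
    (Y : Ω → Fin d → ℝ) (hmeas : Measurable Y)
    (hlaw : P.map Y = Measure.pi (fun i => gaussianReal (μ i) (σ ^ 2)))
    (hatμ : (Fin d → ℝ) → (Fin d → ℝ))
    (hf : ContDiff ℝ 1 hatμ)
    (hbdd : ∃ C : ℝ, ∀ y i j, |fderiv ℝ hatμ y (Pi.single j 1) i| ≤ C) :
    ∫ ω, ((∑ i, (Y ω i - hatμ (Y ω) i) ^ 2) - d * (σ : ℝ) ^ 2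
        + 2 * (σ : ℝ) ^ 2 * ∑ i, fderiv ℝ hatμ (Y ω) (Pi.single i 1) i) ∂P
      = ∫ ω, ∑ i, (μ i - hatμ (Y ω) i) ^ 2 ∂P := by
  obtain ⟨C, hC⟩ := hbdd
  have hd := hf.differentiable one_ne_zero
  have hdi (i) : Differentiable ℝ fun y ↦ hatμ y i := differentiable_pi.1 hd i
  have hfd (y) (i) : fderiv ℝ (fun y ↦ hatμ y i) y
      = (ContinuousLinearMap.proj (R := ℝ) (φ := fun _ : Fin d ↦ ℝ) i) ∘L fderiv ℝ hatμ y :=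
    (hasFDerivAt_pi'.1 (hd y).hasFDerivAt i).fderiv
  have hmain := integral_sure_eq_pi_gaussianReal μ (σ ^ 2) hdi fun i ↦
    exists_lipschitzWith_of_abs_fderiv_single_le (hdi i) fun y j ↦ by
      simpa [hfd] using hC y i j
  have hfdi (i) : Measurable fun y ↦ fderiv ℝ hatμ y (Pi.single i 1) i :=
    (measurable_pi_apply i).comp (measurable_fderiv_apply_const ℝ hatμ (Pi.single i 1))
  have hfi (i) : Measurable fun y ↦ hatμ y i := (hdi i).continuous.measurable
  simp only [hfd, ContinuousLinearMap.comp_apply, ContinuousLinearMap.proj_apply,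
    NNReal.coe_pow, ← hlaw] at hmain
  rwa [integral_map hmeas.aemeasurable (by fun_prop),
    integral_map hmeas.aemeasurable (by fun_prop)] at hmain
end

section
/- (Generalized Stein's lemma) Let Y be a random vector in ℝ^d whose distribution has density p(y; θ) = h(y)·exp(⟨y, θ⟩ − A(θ)) with respect to Lebesgue measure on ℝ^d, where h : ℝ^d → ℝ₊ is continuously differentiable and A : ℝ^d → ℝ is the log-partition function. Let f : ℝ^d → ℝ^d be continuously differentiable with bounded partial derivatives, and assume the integrands below are integrable and h(y)·f(y)·exp(⟨y,θ⟩) vanishes at infinity. Then E⟨θ, f(Y)⟩ = −E[⟨∇h(Y)/h(Y), f(Y)⟩ + tr(∂f/∂y)(Y)]. -/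
open MeasureTheory Filter

/-- A `C¹` vector field with integrable divergence whose components are bounded by
`(1 + ‖y‖) G y` with `G` integrable has divergence of integral zero. -/
theorem integral_divergence_eq_zero_of_bound {ι : Type*} [Fintype ι] [DecidableEq ι]
    (F : ι → (ι → ℝ) → ℝ) (hF : ∀ i, ContDiff ℝ 1 (F i)) (G : (ι → ℝ) → ℝ)
    (hG : Integrable G) (hFG : ∀ i y, |F i y| ≤ (1 + ‖y‖) * G y)
    (hdiv : Integrable fun y => ∑ i, fderiv ℝ (F i) y (Pi.single i 1)) :
    ∫ y, ∑ i, fderiv ℝ (F i) y (Pi.single i 1) = 0 := by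
  let φ : ContDiffBump (0 : ι → ℝ) := ⟨1, 2, one_pos, one_lt_two⟩
  have hφ : ContDiff ℝ 1 φ := φ.contDiff
  have hφd : Differentiable ℝ φ := hφ.differentiable one_ne_zero
  obtain ⟨M, hM⟩ : ∃ M, ∀ y, ‖fderiv ℝ φ y‖ ≤ M :=
    (φ.hasCompactSupport.fderiv (𝕜 := ℝ)).exists_bound_of_continuous
      (hφ.continuous_fderiv one_ne_zero)
  have hM0 : 0 ≤ M := (norm_nonneg _).trans (hM 0)
  have hG0 : ∀ y, (Nonempty ι) → 0 ≤ G y := fun y ⟨i⟩ =>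
    nonneg_of_mul_nonneg_right ((abs_nonneg _).trans (hFG i y)) (by positivity)
  let c : ℕ → ℝ := fun n => ((n : ℝ) + 1)⁻¹
  have hc0 : ∀ n, 0 < c n := fun n => by positivity
  have hc1 : ∀ n, c n ≤ 1 := fun n => inv_le_one_of_one_le₀ (by simp)
  have hc : Tendsto c atTop (nhds 0) := by
    simpa [c, one_div] using tendsto_one_div_add_atTop_nhds_zero_nat (𝕜 := ℝ)
  let χ : ℕ → (ι → ℝ) → ℝ := fun n y => φ (c n • y)
  have hχ : ∀ n, ContDiff ℝ 1 (χ n) := fun n => hφ.comp (contDiff_id.const_smul (c n))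
  have hχd : ∀ n, Differentiable ℝ (χ n) := fun n => (hχ n).differentiable one_ne_zero
  have hχs : ∀ n, HasCompactSupport (χ n) := fun n =>
    φ.hasCompactSupport.comp_smul (hc0 n).ne'
  have hχf : ∀ n y v, fderiv ℝ (χ n) y v = c n * fderiv ℝ φ (c n • y) v := by
    intro n y v
    have h1 : HasFDerivAt (fun y : ι → ℝ => c n • y)
        (c n • ContinuousLinearMap.id ℝ (ι → ℝ)) y := (hasFDerivAt_id y).const_smul (c n)
    have h2 := (hφd (c n • y)).hasFDerivAt.comp y h1
    have h3 : fderiv ℝ (χ n) y = _ := h2.fderiv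
    rw [h3]
    simp
  have hparts : ∀ n, ∫ y, χ n y * ∑ i, fderiv ℝ (F i) y (Pi.single i 1)
      = - ∫ y, ∑ i, fderiv ℝ (χ n) y (Pi.single i 1) * F i y := by
    intro n
    have hFi : ∀ i, Continuous fun y => fderiv ℝ (F i) y (Pi.single i 1) := fun i =>
      ((hF i).continuous_fderiv one_ne_zero).clm_apply continuous_const
    have hχi : ∀ i : ι, Continuous fun y => fderiv ℝ (χ n) y (Pi.single i 1) := fun i =>
      ((hχ n).continuous_fderiv one_ne_zero).clm_apply continuous_const
    have hχis : ∀ i : ι, HasCompactSupport fun y => fderiv ℝ (χ n) y (Pi.single i 1) := fun i =>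
      (hχs n).fderiv_apply (𝕜 := ℝ) (Pi.single i 1)
    have i1 : ∀ i, Integrable fun y => χ n y * fderiv ℝ (F i) y (Pi.single i 1) := fun i =>
      ((hχ n).continuous.mul (hFi i)).integrable_of_hasCompactSupport ((hχs n).mul_right)
    have i2 : ∀ i, Integrable fun y => fderiv ℝ (χ n) y (Pi.single i 1) * F i y := fun i =>
      ((hχi i).mul (hF i).continuous).integrable_of_hasCompactSupport ((hχis i).mul_right)
    have i3 : ∀ i, Integrable fun y => χ n y * F i y := fun i =>
      ((hχ n).continuous.mul (hF i).continuous).integrable_of_hasCompactSupport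
        ((hχs n).mul_right)
    simp_rw [Finset.mul_sum]
    rw [integral_finsetSum _ fun i _ => i1 i, integral_finsetSum _ fun i _ => i2 i,
      ← Finset.sum_neg_distrib]
    exact Finset.sum_congr rfl fun i _ =>
      integral_mul_fderiv_eq_neg_fderiv_mul_of_integrable (i2 i) (i1 i) (i3 i)
        (fun y _ => hχd n y) (fun y _ => (hF i).differentiable one_ne_zero y)
  have hlim1 : Tendsto (fun n => ∫ y, χ n y * ∑ i, fderiv ℝ (F i) y (Pi.single i 1)) atTop
      (nhds (∫ y, ∑ i, fderiv ℝ (F i) y (Pi.single i 1))) := by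
    refine tendsto_integral_of_dominated_convergence
      (fun y => ‖∑ i, fderiv ℝ (F i) y (Pi.single i 1)‖)
      (fun n => (hχ n).continuous.aestronglyMeasurable.mul hdiv.aestronglyMeasurable)
      hdiv.norm (fun n => .of_forall fun y => ?_) (.of_forall fun y => ?_)
    · rw [norm_mul, Real.norm_of_nonneg φ.nonneg]
      exact mul_le_of_le_one_left (norm_nonneg _) φ.le_one
    · have h1 : Tendsto (fun n => c n • y) atTop (nhds 0) := by
        simpa using hc.smul_const y
      have h2 : Tendsto (fun n => χ n y) atTop (nhds 1) := by
        have := (φ.continuous.tendsto 0).comp h1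
        rwa [φ.one_of_mem_closedBall (by simp [φ.rIn_pos.le])] at this
      simpa using h2.mul_const (∑ i, fderiv ℝ (F i) y (Pi.single i 1))
  have hbound : ∀ n y (i : ι), ‖fderiv ℝ (χ n) y (Pi.single i 1) * F i y‖
      ≤ c n * (M * ((1 + ‖y‖) * G y)) := by
    intro n y i
    have h1 : ‖fderiv ℝ φ (c n • y) (Pi.single i 1)‖ ≤ M := by
      have := (fderiv ℝ φ (c n • y)).le_of_opNorm_le (hM _) (Pi.single i (1 : ℝ))
      rwa [Pi.norm_single, norm_one, mul_one] at this
    rw [hχf, norm_mul, norm_mul, Real.norm_of_nonneg (hc0 n).le, mul_assoc]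
    exact mul_le_mul_of_nonneg_left
      (mul_le_mul h1 (hFG i y) (norm_nonneg _) hM0) (hc0 n).le
  have hlim2 : Tendsto (fun n => ∫ y, ∑ i, fderiv ℝ (χ n) y (Pi.single i 1) * F i y) atTop
      (nhds (∫ _ : ι → ℝ, (0 : ℝ))) := by
    refine tendsto_integral_of_dominated_convergence (fun y => ∑ _ : ι, 3 * M * G y)
      (fun n => ?_) (integrable_finsetSum _ fun _ _ => hG.const_mul _)
      (fun n => .of_forall fun y => ?_) (.of_forall fun y => ?_)
    · refine Continuous.aestronglyMeasurable (continuous_finsetSum _ fun i _ => ?_)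
      exact (((hχ n).continuous_fderiv one_ne_zero).clm_apply continuous_const).mul
        (hF i).continuous
    · refine (norm_sum_le _ _).trans (Finset.sum_le_sum fun i _ => ?_)
      have hGy := hG0 y ⟨i⟩
      by_cases hy : c n * ‖y‖ ≤ 2
      · refine (hbound n y i).trans ?_
        have : c n * (M * ((1 + ‖y‖) * G y)) = (c n + c n * ‖y‖) * (M * G y) := by ring
        rw [this, mul_assoc]
        exact mul_le_mul_of_nonneg_right (by linarith [hc1 n]) (by positivity)
      · have h0 : fderiv ℝ φ (c n • y) = 0 := by
          refine image_eq_zero_of_notMem_tsupport fun hmem => hy ?_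
          have := tsupport_fderiv_subset ℝ hmem
          rw [φ.tsupport_eq, mem_closedBall_zero_iff, norm_smul,
            Real.norm_of_nonneg (hc0 n).le] at this
          exact this
        rw [hχf, h0]
        simpa using (by positivity : 0 ≤ 3 * M * G y)
    · have : Tendsto (fun n => ∑ i, fderiv ℝ (χ n) y (Pi.single i 1) * F i y) atTop
          (nhds (∑ _ : ι, (0 : ℝ))) := by
        refine tendsto_finsetSum _ fun i _ => squeeze_zero_norm (fun n => hbound n y i) ?_
        simpa using hc.mul_const (M * ((1 + ‖y‖) * G y))
      simpa using this
  simp_rw [hparts] at hlim1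
  simpa using tendsto_nhds_unique hlim1 hlim2.neg

/-- A differentiable self-map of `ℝ^ι` with bounded partial derivatives grows at most linearly. -/
theorem exists_norm_le_of_abs_partialDeriv_le {ι : Type*} [Fintype ι] [DecidableEq ι]
    {f : (ι → ℝ) → ι → ℝ} (hf : Differentiable ℝ f) {C : ℝ}
    (hC : ∀ y i j, |fderiv ℝ f y (Pi.single j 1) i| ≤ C) :
    ∃ K, 0 ≤ K ∧ ∀ y, ‖f y‖ ≤ K * (1 + ‖y‖) := by
  have hC' : ∀ y i j, |fderiv ℝ f y (Pi.single j 1) i| ≤ |C| := fun y i j =>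
    (hC y i j).trans (le_abs_self C)
  set L : ℝ := ∑ _ : ι, |C| with hL
  have hL0 : 0 ≤ L := Finset.sum_nonneg fun _ _ => abs_nonneg C
  have hder : ∀ y, ‖fderiv ℝ f y‖ ≤ L := by
    refine fun y => ContinuousLinearMap.opNorm_le_bound _ hL0 fun v => ?_
    rw [pi_norm_le_iff_of_nonneg (by positivity)]
    intro i
    have hv : v = ∑ j, v j • (Pi.single j (1 : ℝ) : ι → ℝ) := pi_eq_sum_univ' v
    conv_lhs => rw [hv]
    simp only [map_sum, map_smul, Finset.sum_apply, Pi.smul_apply, smul_eq_mul]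
    rw [hL, Finset.sum_mul]
    refine (norm_sum_le _ _).trans (Finset.sum_le_sum fun j _ => ?_)
    rw [norm_mul, mul_comm]
    exact mul_le_mul (hC' y i j) (norm_le_pi_norm v j) (norm_nonneg _) (abs_nonneg C)
  refine ⟨‖f 0‖ + L, by positivity, fun y => ?_⟩
  have h1 : ‖f y - f 0‖ ≤ L * ‖y - 0‖ :=
    convex_univ.norm_image_sub_le_of_norm_fderiv_le (fun x _ => hf x) (fun x _ => hder x)
      (Set.mem_univ 0) (Set.mem_univ y)
  rw [sub_zero] at h1
  have h2 : ‖f y‖ ≤ ‖f 0‖ + ‖f y - f 0‖ := norm_le_insert' _ _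
  nlinarith [norm_nonneg (f 0), norm_nonneg y]

/-- Generalized Stein's lemma: for `Y` with density
`h(y) exp(⟨y,θ⟩ − A(θ))` w.r.t. Lebesgue measure on `ℝ^d`, `h` continuously differentiable,
and `f` continuously differentiable with bounded partial derivatives, assuming integrability and
decay at infinity of `h f exp⟨·,θ⟩`,
`E⟨θ, f(Y)⟩ = −E[⟨∇h(Y)/h(Y), f(Y)⟩ + tr (∂f/∂y)(Y)]`. -/
theorem generalized_stein_lemma
    {Ω : Type*} [MeasurableSpace Ω] (P : Measure Ω) [IsProbabilityMeasure P]
    (d : ℕ) (θ : Fin d → ℝ) (h : (Fin d → ℝ) → ℝ) (A : (Fin d → ℝ) → ℝ)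
    (hpos : ∀ y, 0 ≤ h y) (hh : ContDiff ℝ 1 h)
    (Y : Ω → Fin d → ℝ) (hmeas : Measurable Y)
    (hlaw : P.map Y
      = volume.withDensity (fun y => ENNReal.ofReal (h y * Real.exp ((∑ i, y i * θ i) - A θ))))
    (f : (Fin d → ℝ) → (Fin d → ℝ))
    (hf : ContDiff ℝ 1 f)
    (hbdd : ∃ C : ℝ, ∀ y i j, |fderiv ℝ f y (Pi.single j 1) i| ≤ C)
    (hint1 : Integrable (fun ω => ∑ i, θ i * f (Y ω) i) P)
    (hint2 : Integrable (fun ω =>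
      (∑ i, (fderiv ℝ h (Y ω) (Pi.single i 1) / h (Y ω)) * f (Y ω) i)
        + ∑ i, fderiv ℝ f (Y ω) (Pi.single i 1) i) P)
    (hdecay : ∀ i, Tendsto (fun y : Fin d → ℝ => h y * f y i * Real.exp (∑ j, y j * θ j))
      (cocompact (Fin d → ℝ)) (nhds 0)) :
    ∫ ω, ∑ i, θ i * f (Y ω) i ∂P
      = - ∫ ω, ((∑ i, (fderiv ℝ h (Y ω) (Pi.single i 1) / h (Y ω)) * f (Y ω) i)
          + ∑ i, fderiv ℝ f (Y ω) (Pi.single i 1) i) ∂P := by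
  set q : (Fin d → ℝ) → ℝ := fun y => h y * Real.exp ((∑ i, y i * θ i) - A θ) with hq
  have hq0 : ∀ y, 0 ≤ q y := fun y => mul_nonneg (hpos y) (Real.exp_pos _).le
  have hhd : Differentiable ℝ h := hh.differentiable one_ne_zero
  have hfd : Differentiable ℝ f := hf.differentiable one_ne_zero
  have hqC : ContDiff ℝ 1 q := by fun_prop
  have hqint : Integrable q := by
    refine ⟨hqC.continuous.aestronglyMeasurable, ?_⟩
    rw [hasFiniteIntegral_iff_ofReal (.of_forall hq0)]
    have h1 : P.map Y Set.univ = 1 := by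
      have := Measure.isProbabilityMeasure_map (μ := P) hmeas.aemeasurable
      exact measure_univ
    rw [hlaw, withDensity_apply _ MeasurableSet.univ, setLIntegral_univ] at h1
    rw [h1]
    exact ENNReal.one_lt_top
  obtain ⟨C, hC⟩ := hbdd
  obtain ⟨K, hK0, hK⟩ := exists_norm_le_of_abs_partialDeriv_le hfd hC
  have hfi : ∀ i, ContDiff ℝ 1 fun y => f y i := fun i => contDiff_pi.1 hf i
  set T : (Fin d → ℝ) → ℝ := fun y =>
    (∑ i, (fderiv ℝ h y (Pi.single i 1) / h y) * f y i) + ∑ i, fderiv ℝ f y (Pi.single i 1) i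
    with hT
  have hdh : ∀ y v, h y * (fderiv ℝ h y v / h y) = fderiv ℝ h y v := by
    intro y v
    by_cases hy : h y = 0
    · have hmin : IsLocalMin h y := .of_forall fun z => hy ▸ hpos z
      simp [hmin.fderiv_eq_zero]
    · field_simp
  have hexp : ∀ y, HasFDerivAt (fun y : Fin d → ℝ => Real.exp ((∑ i, y i * θ i) - A θ))
      (Real.exp ((∑ i, y i * θ i) - A θ) •
        ∑ i, θ i • (ContinuousLinearMap.proj i : (Fin d → ℝ) →L[ℝ] ℝ)) y := by
    intro y
    refine HasFDerivAt.exp (HasFDerivAt.sub_const _ (HasFDerivAt.fun_sum fun i _ => ?_))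
    exact (hasFDerivAt_apply i y).mul_const (θ i)
  have hdiv : ∀ y, ∑ i, fderiv ℝ (fun z => q z * f z i) y (Pi.single i 1)
      = q y * ((∑ i, θ i * f y i) + T y) := by
    intro y
    simp only [hT, mul_add, Finset.mul_sum, ← Finset.sum_add_distrib]
    refine Finset.sum_congr rfl fun i _ => ?_
    have h1 := ((hhd y).hasFDerivAt.mul (hexp y)).mul (hasFDerivAt_pi'.1 (hfd y).hasFDerivAt i)
    have h2 : fderiv ℝ (fun z => q z * f z i) y = _ := h1.fderiv
    rw [h2]
    have h3 := hdh y (Pi.single i 1)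
    simp [Pi.single_apply, hq]
    linear_combination (-Real.exp ((∑ i, y i * θ i) - A θ) * f y i) * h3
  have hSc : Continuous fun y => ∑ i, θ i * f y i :=
    continuous_finsetSum _ fun i _ => continuous_const.mul (hfi i).continuous
  have hTm : Measurable T := by
    have hfh : ∀ i : Fin d, Continuous fun y => fderiv ℝ h y (Pi.single i 1) := fun i =>
      (hh.continuous_fderiv one_ne_zero).clm_apply continuous_const
    have hff : ∀ i : Fin d, Continuous fun y => fderiv ℝ f y (Pi.single i 1) i := fun i =>
      (continuous_apply i).comp ((hf.continuous_fderiv one_ne_zero).clm_apply continuous_const)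
    exact (Finset.measurable_sum _ fun i _ =>
      ((hfh i).measurable.div hh.continuous.measurable).mul (hfi i).continuous.measurable).add
      (Finset.measurable_sum _ fun i _ => (hff i).measurable)
  have hSTm : Measurable fun y => (∑ i, θ i * f y i) + T y := hSc.measurable.add hTm
  have hqm : Measurable fun y => ENNReal.ofReal (q y) := hqC.continuous.measurable.ennreal_ofReal
  have hqtop : ∀ᵐ y : Fin d → ℝ, ENNReal.ofReal (q y) < ⊤ :=
    .of_forall fun _ => ENNReal.ofReal_lt_top
  have hint : Integrable fun y => q y * ((∑ i, θ i * f y i) + T y) := by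
    have h1 : Integrable (fun y => (∑ i, θ i * f y i) + T y) (P.map Y) :=
      (integrable_map_measure hSTm.aestronglyMeasurable hmeas.aemeasurable).2 (hint1.add hint2)
    rw [hlaw, integrable_withDensity_iff_integrable_smul' hqm hqtop] at h1
    simpa only [ENNReal.toReal_ofReal (hq0 _), smul_eq_mul] using h1
  have hzero : ∫ y, q y * ((∑ i, θ i * f y i) + T y) = 0 := by
    simp_rw [← hdiv] at hint ⊢
    refine integral_divergence_eq_zero_of_bound (fun i z => q z * f z i)
      (fun i => hqC.mul (hfi i)) (fun y => K * q y) (hqint.const_mul K) (fun i y => ?_) hint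
    rw [abs_mul, abs_of_nonneg (hq0 y)]
    have := mul_le_mul_of_nonneg_left ((norm_le_pi_norm (f y) i).trans (hK y)) (hq0 y)
    rw [Real.norm_eq_abs] at this
    linarith
  have hsum : ∫ ω, ((∑ i, θ i * f (Y ω) i) + T (Y ω)) ∂P = 0 := by
    rw [← integral_map hmeas.aemeasurable
      (f := fun y => (∑ i, θ i * f y i) + T y) hSTm.aestronglyMeasurable, hlaw,
      integral_withDensity_eq_integral_toReal_smul hqm hqtop]
    simpa only [ENNReal.toReal_ofReal (hq0 _), smul_eq_mul] using hzero
  rw [integral_add hint1 hint2] at hsum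
  exact eq_neg_of_add_eq_zero_left hsum
end

section
/- Let Y be a random vector in ℝ^d with independent entries, where each entry Y_i follows a Gamma distribution with density (L^L y^{L−1})/(Γ(L)·μ_i^L)·exp(−L·y/μ_i) on ℝ₊, with shape parameter L > 2 and mean μ_i > 0. Let μ̂ : ℝ^d → ℝ^d be continuously differentiable with bounded partial derivatives, and assume all the expectations below are finite. Then the statistic ∑_{i=1}^d [ L²/μ̂_i(Y)² − 2L(L−1)/(Y_i·μ̂_i(Y)) + (2L/μ̂_i(Y)²)·(∂μ̂_i/∂y_i)(Y) + (L−1)(L−2)/Y_i² ] is an unbiased estimator of L²·E[∑_{i=1}^d (1/μ_i − 1/μ̂_i(Y))²]. -/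
open MeasureTheory ProbabilityTheory

lemma gammaPDFReal_eq_zero_of_nonpos {a r t : ℝ} (ha : 1 < a) (ht : t ≤ 0) :
    gammaPDFReal a r t = 0 := by
  rcases ht.lt_or_eq with h | rfl
  · simp [gammaPDFReal, h.not_ge]
  · simp [gammaPDFReal, Real.zero_rpow (sub_pos.2 ha).ne']

lemma integrable_gammaMeasure_iff {a r : ℝ} (ha : 1 < a) (hr : 0 < r) {g : ℝ → ℝ} :
    Integrable g (gammaMeasure a r) ↔
      IntegrableOn (fun t => gammaPDFReal a r t * g t) (Set.Ioi 0) := by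
  have h : Integrable g (gammaMeasure a r) ↔
      Integrable (fun t => (gammaPDFReal a r t).toNNReal • g t) :=
    integrable_withDensity_iff_integrable_smul (measurable_gammaPDFReal a r).real_toNNReal
  rw [h, integrableOn_iff_integrable_of_support_subset]
  · refine integrable_congr (.of_forall fun t => ?_)
    simp [NNReal.smul_def, gammaPDFReal_nonneg (zero_lt_one.trans ha) hr]
  · intro t ht
    by_contra h0
    exact ht (by simp [gammaPDFReal_eq_zero_of_nonpos ha (not_lt.1 h0)])

lemma integral_gammaMeasure {a r : ℝ} (ha : 1 < a) (hr : 0 < r) (g : ℝ → ℝ) :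
    ∫ t, g t ∂gammaMeasure a r = ∫ t in Set.Ioi 0, gammaPDFReal a r t * g t := by
  have h : ∫ t, g t ∂gammaMeasure a r = ∫ t, (gammaPDFReal a r t).toNNReal • g t :=
    integral_withDensity_eq_integral_smul (measurable_gammaPDFReal a r).real_toNNReal g
  rw [h, setIntegral_eq_integral_of_forall_compl_eq_zero]
  · refine integral_congr_ae (.of_forall fun t => ?_)
    simp [NNReal.smul_def, gammaPDFReal_nonneg (zero_lt_one.trans ha) hr]
  · intro t ht
    simp [gammaPDFReal_eq_zero_of_nonpos ha (not_lt.1 ht)]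

lemma integral_inv_sq_gammaMeasure {a r : ℝ} (ha : 2 < a) (hr : 0 < r) :
    ∫ t, (t ^ 2)⁻¹ ∂gammaMeasure a r = r ^ 2 / ((a - 1) * (a - 2)) := by
  have h1 : (a - 1) ≠ 0 := by linarith
  have h2 : (a - 2) ≠ 0 := by linarith
  have hG : Real.Gamma a = (a - 1) * ((a - 2) * Real.Gamma (a - 2)) := by
    rw [← Real.Gamma_add_one h2, show a - 2 + 1 = a - 1 by ring, ← Real.Gamma_add_one h1,
      sub_add_cancel]
  have hG2 : Real.Gamma (a - 2) ≠ 0 := (Real.Gamma_pos_of_pos (by linarith)).ne'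
  have hp : ∀ t ∈ Set.Ioi (0 : ℝ), gammaPDFReal a r t * (t ^ 2)⁻¹ =
      r ^ a / Real.Gamma a * (t ^ (a - 2 - 1) * Real.exp (-(r * t))) := by
    intro t ht
    have ht' : (0 : ℝ) < t := ht
    rw [gammaPDFReal, if_pos ht'.le, show a - 2 - 1 = a - 1 - (2 : ℕ) by push_cast; ring,
      Real.rpow_sub_natCast ht'.ne']
    field_simp
  rw [integral_gammaMeasure (by linarith) hr, setIntegral_congr_fun measurableSet_Ioi hp,
    integral_const_mul, Real.integral_rpow_mul_exp_neg_mul_Ioi (by linarith) hr, hG,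
    one_div, Real.inv_rpow hr.le, show a - 2 = a - (2 : ℕ) by push_cast; ring,
    Real.rpow_sub_natCast hr.ne']
  push_cast
  have := (Real.rpow_pos_of_pos hr a).ne'
  field_simp

lemma integrable_inv_sq_gammaMeasure {a r : ℝ} (ha : 2 < a) (hr : 0 < r) :
    Integrable (fun t => (t ^ 2)⁻¹) (gammaMeasure a r) := by
  by_contra h
  have h0 := integral_inv_sq_gammaMeasure ha hr
  rw [integral_undef h] at h0
  have : 0 < r ^ 2 / ((a - 1) * (a - 2)) :=
    div_pos (by positivity) (mul_pos (by linarith) (by linarith))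
  linarith

/-- A function on `(0, ∞)` whose derivative is integrable, and which is itself integrable against
`dt / t`, vanishes at both ends. -/
lemma setIntegral_Ioi_deriv_eq_zero {F F' : ℝ → ℝ} (hF : ∀ t, 0 < t → HasDerivAt F (F' t) t)
    (hF' : IntegrableOn F' (Set.Ioi 0)) (hFt : IntegrableOn (fun t => F t / t) (Set.Ioi 0)) :
    ∫ t in Set.Ioi 0, F' t = 0 := by
  have himg : Real.exp '' Set.univ = Set.Ioi 0 := by rw [Set.image_univ, Real.range_exp]
  have hd : ∀ x ∈ Set.univ, HasDerivWithinAt Real.exp (Real.exp x) Set.univ x :=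
    fun x _ => (Real.hasDerivAt_exp x).hasDerivWithinAt
  have hinj := Real.exp_injective.injOn (s := Set.univ)
  rw [← himg] at hF' hFt ⊢
  rw [integrableOn_image_iff_integrableOn_abs_deriv_smul .univ hd hinj, integrableOn_univ]
    at hF' hFt
  rw [integral_image_eq_integral_abs_deriv_smul .univ hd hinj, setIntegral_univ]
  refine integral_eq_zero_of_hasDerivAt_of_integrable (f := fun x => F (Real.exp x))
    (fun x => ?_) hF' ?_
  · refine ((hF _ (Real.exp_pos x)).comp x (Real.hasDerivAt_exp x)).congr_deriv ?_
    rw [abs_of_pos (Real.exp_pos x), smul_eq_mul, mul_comm]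
  · refine hFt.congr (.of_forall fun x => ?_)
    simp [abs_of_pos (Real.exp_pos x), mul_div_cancel₀]

/-- If the reciprocal of a Lipschitz function is integrable, a zero of the function propagates. -/
lemma eq_zero_of_intervalIntegrable_inv {f f' : ℝ → ℝ} {C a b : ℝ}
    (hf : ∀ t, HasDerivAt f (f' t) t) (hC : ∀ t, |f' t| ≤ C)
    (hint : IntervalIntegrable (fun t => (f t)⁻¹) volume a b) (ha : f a = 0) : f b = 0 := by
  by_contra hb
  have hC0 : 0 ≤ C := (abs_nonneg _).trans (hC 0)
  have hfc : Continuous f := continuous_iff_continuousAt.2 fun t => (hf t).continuousAt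
  have hf'm : Measurable f' := by
    rw [show f' = deriv f from funext fun t => (hf t).deriv.symm]
    exact measurable_deriv f
  have hbd : IntervalIntegrable (fun t => 2 * C * |(f t)⁻¹|) volume a b :=
    hint.abs.const_mul _
  set K := abs (∫ t in a..b, 2 * C * |(f t)⁻¹|) with hK
  have hb2 : 0 < f b ^ 2 := by positivity
  set ε := f b ^ 2 * Real.exp (-K) with hε
  have hε0 : 0 < ε := by positivity
  have hpos : ∀ t, 0 < f t ^ 2 + ε := fun t => by positivity
  have hle : ∀ t, ‖2 * f t * f' t / (f t ^ 2 + ε)‖ ≤ 2 * C * |(f t)⁻¹| := by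
    intro t
    rcases eq_or_ne (f t) 0 with h0 | h0
    · simp [h0]
    · rw [norm_div, norm_mul, norm_mul, Real.norm_eq_abs, Real.norm_eq_abs, Real.norm_eq_abs,
        Real.norm_eq_abs, abs_of_pos (hpos t), abs_two, abs_inv, div_le_iff₀ (hpos t)]
      have h1 : 0 < |f t| := abs_pos.2 h0
      calc 2 * |f t| * |f' t| ≤ 2 * |f t| * C := by gcongr; exact hC t
        _ = 2 * C * |f t|⁻¹ * f t ^ 2 := by rw [← sq_abs (f t)]; field_simp
        _ ≤ 2 * C * |f t|⁻¹ * (f t ^ 2 + ε) := by gcongr; linarith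
  have hderiv : ∀ t, HasDerivAt (fun t => Real.log (f t ^ 2 + ε))
      (2 * f t * f' t / (f t ^ 2 + ε)) t := by
    intro t
    refine ((((hf t).pow 2).add_const ε).log (hpos t).ne').congr_deriv ?_
    simp
  have hii : IntervalIntegrable (fun t => 2 * f t * f' t / (f t ^ 2 + ε)) volume a b :=
    hbd.mono_fun (by fun_prop : Measurable _).aestronglyMeasurable
      (.of_forall fun t => (hle t).trans (le_abs_self _))
  have h1 := intervalIntegral.norm_integral_le_abs_of_norm_le (.of_forall hle) hbd
  rw [intervalIntegral.integral_eq_sub_of_hasDerivAt (fun t _ => hderiv t) hii, ← hK, ha] at h1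
  have h2 := (le_abs_self _).trans h1
  have h3 : Real.log (f b ^ 2) < Real.log (f b ^ 2 + ε) := Real.log_lt_log hb2 (by linarith)
  have h4 : Real.log ε = Real.log (f b ^ 2) - K := by
    rw [hε, Real.log_mul hb2.ne' (Real.exp_pos _).ne', Real.log_exp]; ring
  simp only [ne_eq, OfNat.ofNat_ne_zero, not_false_eq_true, zero_pow, zero_add] at h2
  linarith

lemma hasDerivAt_gammaPDFReal {a r t : ℝ} (ht : 0 < t) :
    HasDerivAt (gammaPDFReal a r) (gammaPDFReal a r t * ((a - 1) / t - r)) t := by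
  have h : HasDerivAt (fun t => r ^ a / Real.Gamma a * t ^ (a - 1) * Real.exp (-(r * t)))
      (gammaPDFReal a r t * ((a - 1) / t - r)) t := by
    have h1 := (Real.hasDerivAt_rpow_const (p := a - 1) (Or.inl ht.ne')).const_mul
      (r ^ a / Real.Gamma a)
    have h2 := (((hasDerivAt_id t).const_mul r).neg).exp
    refine (h1.mul h2).congr_deriv ?_
    simp only [gammaPDFReal, if_pos ht.le, Real.rpow_sub_one ht.ne' (a - 1)]
    simp only [id, Pi.neg_apply]
    field_simp
    ring
  refine h.congr_of_eventuallyEq ?_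
  filter_upwards [lt_mem_nhds ht] with s hs
  rw [gammaPDFReal, if_pos hs.le]

/-- Stein's identity for the Gamma distribution, applied to the reciprocal of a function with
bounded derivative. -/
lemma integral_stein_inv_gammaMeasure {a r C : ℝ} (ha : 2 < a) (hr : 0 < r) {f f' : ℝ → ℝ}
    (hf : ∀ t, HasDerivAt f (f' t) t) (hC : ∀ t, |f' t| ≤ C)
    (hint : Integrable (fun t => (f t)⁻¹) (gammaMeasure a r))
    (hint_div : Integrable (fun t => t⁻¹ * (f t)⁻¹) (gammaMeasure a r))
    (hint_deriv : Integrable (fun t => f' t * ((f t)⁻¹) ^ 2) (gammaMeasure a r)) :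
    ∫ t, ((a - 1) * (t⁻¹ * (f t)⁻¹) - r * (f t)⁻¹ - f' t * ((f t)⁻¹) ^ 2)
      ∂gammaMeasure a r = 0 := by
  have ha1 : 1 < a := by linarith
  by_cases hz : ∃ t₀, 0 < t₀ ∧ f t₀ = 0
  · obtain ⟨t₀, ht₀, h0⟩ := hz
    have hall : ∀ t, 0 < t → f t = 0 := by
      intro t ht
      have hsub : Set.uIcc t₀ t ⊆ Set.Ioi 0 := fun s hs =>
        (lt_min ht₀ ht).trans_le (Set.mem_Icc.1 hs).1
      refine eq_zero_of_intervalIntegrable_inv hf hC ?_ h0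
      have h1 : IntervalIntegrable (fun s => gammaPDFReal a r s * (f s)⁻¹) volume t₀ t :=
        (((integrable_gammaMeasure_iff ha1 hr).1 hint).mono_set hsub).intervalIntegrable
      have h2 : ContinuousOn (fun s => (gammaPDFReal a r s)⁻¹) (Set.uIcc t₀ t) := fun s hs =>
        ((hasDerivAt_gammaPDFReal (hsub hs)).continuousAt.inv₀
          (gammaPDFReal_pos (by linarith) hr (hsub hs)).ne').continuousWithinAt
      refine (h1.continuousOn_mul h2).congr fun s hs => ?_
      have := (gammaPDFReal_pos (a := a) (by linarith) hr
        (hsub (Set.uIoc_subset_uIcc hs))).ne'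
      exact inv_mul_cancel_left₀ this _
    rw [integral_gammaMeasure ha1 hr]
    refine setIntegral_eq_zero_of_forall_eq_zero fun t ht => ?_
    simp [hall t ht]
  · push Not at hz
    have hI := ((hint_div.const_mul (a - 1)).sub (hint.const_mul r)).sub hint_deriv
    rw [integral_gammaMeasure ha1 hr]
    refine setIntegral_Ioi_deriv_eq_zero (F := fun t => gammaPDFReal a r t * (f t)⁻¹)
      (fun t ht => ?_) ((integrable_gammaMeasure_iff ha1 hr).1 hI) ?_
    · refine ((hasDerivAt_gammaPDFReal ht).mul ((hf t).inv (hz t ht))).congr_deriv ?_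
      have := hz t ht
      simp only [Pi.inv_apply]
      field_simp
      ring
    · refine ((integrable_gammaMeasure_iff ha1 hr).1 hint_div).congr_fun (fun t _ => ?_)
        measurableSet_Ioi
      ring

/-- Stein's identity in the `i`-th coordinate of a product of Gamma distributions. -/
lemma integral_stein_inv_pi_gammaMeasure {d : ℕ} {a C : ℝ} (ha : 2 < a) {r : Fin d → ℝ}
    (hr : ∀ i, 0 < r i) (i : Fin d) {f : (Fin d → ℝ) → ℝ} (hf : Differentiable ℝ f)
    (hC : ∀ y, |fderiv ℝ f y (Pi.single i 1)| ≤ C)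
    (hint : Integrable (fun y => (f y)⁻¹) (Measure.pi fun i => gammaMeasure a (r i)))
    (hint_div : Integrable (fun y => (y i)⁻¹ * (f y)⁻¹)
      (Measure.pi fun i => gammaMeasure a (r i)))
    (hint_deriv : Integrable (fun y => fderiv ℝ f y (Pi.single i 1) * ((f y)⁻¹) ^ 2)
      (Measure.pi fun i => gammaMeasure a (r i))) :
    ∫ y, ((a - 1) * ((y i)⁻¹ * (f y)⁻¹) - r i * (f y)⁻¹
        - fderiv ℝ f y (Pi.single i 1) * ((f y)⁻¹) ^ 2)
      ∂Measure.pi (fun i => gammaMeasure a (r i)) = 0 := by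
  obtain _ | n := d
  · exact i.elim0
  have : ∀ j, IsProbabilityMeasure (gammaMeasure a (r j)) := fun j =>
    isProbabilityMeasure_gammaMeasure (by linarith) (hr j)
  have hmp := (measurePreserving_piFinSuccAbove (fun j => gammaMeasure a (r j)) i).symm
  have hsymm : ∀ p : ℝ × (Fin n → ℝ),
      (MeasurableEquiv.piFinSuccAbove (fun _ => ℝ) i).symm p = i.insertNth p.1 p.2 :=
    fun _ => rfl
  rw [← hmp.integrable_comp_emb (MeasurableEquiv.measurableEmbedding _)] at hint hint_div hint_deriv
  have hI := ((hint_div.const_mul (a - 1)).sub (hint.const_mul (r i))).sub hint_deriv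
  rw [← hmp.integral_comp']
  refine (integral_prod_symm _ hI).trans ?_
  refine integral_eq_zero_of_ae ?_
  filter_upwards [hint.prod_left_ae, hint_div.prod_left_ae, hint_deriv.prod_left_ae]
    with z h1 h2 h3
  simp only [Function.comp_def, hsymm, Fin.insertNth_apply_same] at h1 h2 h3 ⊢
  refine integral_stein_inv_gammaMeasure ha (hr i)
    (f := fun t => f (i.insertNth (α := fun _ => ℝ) t z)) (fun t => ?_) (fun t => hC _) h1 h2 h3
  have hu : HasDerivAt (fun t => i.insertNth (α := fun _ => ℝ) t z) (Pi.single i 1) t :=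
    (hasDerivAt_update (i.insertNth (α := fun _ => ℝ) 0 z) i t).congr_of_eventuallyEq
      (.of_forall fun s => (Fin.update_insertNth (α := fun _ => ℝ) i 0 s z).symm)
  exact (hf _).hasFDerivAt.comp_hasDerivAt t hu

/-- under i.i.d.-entry Gamma noise with shape `L > 2` and means `μ_i > 0`
(i.e. rate `L/μ_i`), the Gamma GSURE statistic unbiasedly estimates
`L² E[∑ i (1/μ_i − 1/μ̂_i(Y))²]`. -/
theorem gsure_gamma_unbiased
    {Ω : Type*} [MeasurableSpace Ω] (P : Measure Ω) [IsProbabilityMeasure P]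
    (d : ℕ) (L : ℝ) (hL : 2 < L) (μ : Fin d → ℝ) (hμ : ∀ i, 0 < μ i)
    (Y : Ω → Fin d → ℝ) (hmeas : Measurable Y)
    (hlaw : P.map Y = Measure.pi (fun i => gammaMeasure L (L / μ i)))
    (hatμ : (Fin d → ℝ) → (Fin d → ℝ))
    (hf : ContDiff ℝ 1 hatμ)
    (hbdd : ∃ C : ℝ, ∀ y i j, |fderiv ℝ hatμ y (Pi.single j 1) i| ≤ C)
    (hint1 : Integrable (fun ω => ∑ i,
      (L ^ 2 / hatμ (Y ω) i ^ 2
        - 2 * L * (L - 1) / (Y ω i * hatμ (Y ω) i)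
        + 2 * L / hatμ (Y ω) i ^ 2 * fderiv ℝ hatμ (Y ω) (Pi.single i 1) i
        + (L - 1) * (L - 2) / Y ω i ^ 2)) P)
    (hint2 : Integrable (fun ω => ∑ i, (1 / μ i - 1 / hatμ (Y ω) i) ^ 2) P) :
    ∫ ω, ∑ i,
        (L ^ 2 / hatμ (Y ω) i ^ 2
          - 2 * L * (L - 1) / (Y ω i * hatμ (Y ω) i)
          + 2 * L / hatμ (Y ω) i ^ 2 * fderiv ℝ hatμ (Y ω) (Pi.single i 1) i
          + (L - 1) * (L - 2) / Y ω i ^ 2) ∂P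
      = L ^ 2 * ∫ ω, ∑ i, (1 / μ i - 1 / hatμ (Y ω) i) ^ 2 ∂P := by
  set Q : Measure (Fin d → ℝ) := Measure.pi (fun i => gammaMeasure L (L / μ i))
  have hr : ∀ i, 0 < L / μ i := fun i => div_pos (by linarith) (hμ i)
  have hprob : ∀ i, IsProbabilityMeasure (gammaMeasure L (L / μ i)) := fun i =>
    isProbabilityMeasure_gammaMeasure (by linarith) (hr i)
  obtain ⟨C, hC⟩ := hbdd
  have hYmp : MeasurePreserving Y P Q := ⟨hmeas, hlaw⟩
  have hdiff : ∀ i, Differentiable ℝ (fun y => hatμ y i) := fun i =>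
    differentiable_pi.1 (hf.differentiable (by simp)) i
  have hfd : ∀ i y v, fderiv ℝ (fun y => hatμ y i) y v = fderiv ℝ hatμ y v i := by
    intro i y v
    rw [fderiv_apply (hf.differentiable (by simp) y)]
    rfl
  have hm : ∀ i, Measurable (fun y => hatμ y i) := fun i => (hdiff i).continuous.measurable
  have hfdm : ∀ i, Measurable (fun y => fderiv ℝ hatμ y (Pi.single i 1) i) := fun i =>
    ((continuous_apply i).comp
      ((hf.continuous_fderiv (by simp)).clm_apply continuous_const)).measurable
  have hlossm : ∀ i, Measurable (fun y => (1 / μ i - 1 / hatμ y i) ^ 2) := fun i => by fun_prop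
  have hlosssum : Measurable (fun y => ∑ i, (1 / μ i - 1 / hatμ y i) ^ 2) :=
    Finset.measurable_fun_sum _ fun i _ => hlossm i
  have hloss : Integrable (fun y => ∑ i, (1 / μ i - 1 / hatμ y i) ^ 2) Q := by
    rw [← hYmp.integrable_comp hlosssum.aestronglyMeasurable]
    exact hint2
  have hloss_i : ∀ i, Integrable (fun y => (1 / μ i - 1 / hatμ y i) ^ 2) Q := by
    intro i
    refine hloss.mono' (hlossm i).aestronglyMeasurable (.of_forall fun y => ?_)
    rw [Real.norm_of_nonneg (sq_nonneg _)]
    exact Finset.single_le_sum (f := fun i => (1 / μ i - 1 / hatμ y i) ^ 2)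
      (fun j _ => sq_nonneg _) (Finset.mem_univ i)
  have hinv2 : ∀ i, MemLp (fun y => (hatμ y i)⁻¹) 2 Q := by
    intro i
    have h1 : MemLp (fun y => 1 / μ i - 1 / hatμ y i) 2 Q :=
      (memLp_two_iff_integrable_sq
        (by fun_prop : Measurable _).aestronglyMeasurable).2 (hloss_i i)
    refine ((memLp_const (1 / μ i)).sub h1).ae_eq (.of_forall fun y => ?_)
    simp
  have hinv : ∀ i, Integrable (fun y => (hatμ y i)⁻¹) Q := fun i =>
    (hinv2 i).integrable (by norm_num)
  have hYinv : ∀ i, Integrable (fun y : Fin d → ℝ => ((y i) ^ 2)⁻¹) Q := fun i =>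
    (measurePreserving_eval (fun i => gammaMeasure L (L / μ i)) i).integrable_comp_of_integrable
      (integrable_inv_sq_gammaMeasure hL (hr i))
  have hYinv2 : ∀ i, MemLp (fun y : Fin d → ℝ => (y i)⁻¹) 2 Q := fun i =>
    (memLp_two_iff_integrable_sq
      (by fun_prop : Measurable _).aestronglyMeasurable).2 (by simpa only [inv_pow] using hYinv i)
  have hdiv : ∀ i, Integrable (fun y : Fin d → ℝ => (y i)⁻¹ * (hatμ y i)⁻¹) Q := fun i =>
    (hYinv2 i).integrable_mul (hinv2 i)
  have hder : ∀ i, Integrable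
      (fun y => fderiv ℝ hatμ y (Pi.single i 1) i * ((hatμ y i)⁻¹) ^ 2) Q := fun i =>
    (hinv2 i).integrable_sq.bdd_mul (hfdm i).aestronglyMeasurable (.of_forall fun y => hC y i i)
  have hstein : ∀ i, ∫ y, ((L - 1) * ((y i)⁻¹ * (hatμ y i)⁻¹) - L / μ i * (hatμ y i)⁻¹
      - fderiv ℝ hatμ y (Pi.single i 1) i * ((hatμ y i)⁻¹) ^ 2) ∂Q = 0 := by
    intro i
    have h := integral_stein_inv_pi_gammaMeasure (C := C) hL hr i (hdiff i)
      (fun y => by rw [hfd]; exact hC y i i) (hinv i) (hdiv i) (by simpa only [hfd] using hder i)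
    simpa only [hfd] using h
  have hsq : ∀ i, ∫ y, ((y i) ^ 2)⁻¹ ∂Q = (L / μ i) ^ 2 / ((L - 1) * (L - 2)) := by
    intro i
    have he := measurePreserving_eval (fun i => gammaMeasure L (L / μ i)) i
    rw [← integral_inv_sq_gammaMeasure hL (hr i), ← he.map_eq,
      integral_map he.measurable.aemeasurable (by fun_prop : Measurable _).aestronglyMeasurable]
  have hI1 : ∀ i, Integrable (fun y =>
      (L - 1) * ((y i)⁻¹ * (hatμ y i)⁻¹) - L / μ i * (hatμ y i)⁻¹
      - fderiv ℝ hatμ y (Pi.single i 1) i * ((hatμ y i)⁻¹) ^ 2) Q := fun i =>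
    (((hdiv i).const_mul (L - 1)).sub ((hinv i).const_mul (L / μ i))).sub (hder i)
  have hI2 : ∀ i, Integrable (fun y => L ^ 2 * (1 / μ i - 1 / hatμ y i) ^ 2
      + -(2 * L) * ((L - 1) * ((y i)⁻¹ * (hatμ y i)⁻¹) - L / μ i * (hatμ y i)⁻¹
        - fderiv ℝ hatμ y (Pi.single i 1) i * ((hatμ y i)⁻¹) ^ 2)) Q := fun i =>
    ((hloss_i i).const_mul _).add ((hI1 i).const_mul _)
  have hI3 : ∀ i, Integrable (fun y : Fin d → ℝ =>
      (L - 1) * (L - 2) * ((y i) ^ 2)⁻¹ - (L / μ i) ^ 2) Q := fun i =>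
    ((hYinv i).const_mul _).sub (integrable_const _)
  have hterm : ∀ i, ∫ y, (L ^ 2 * (1 / μ i - 1 / hatμ y i) ^ 2
      + -(2 * L) * ((L - 1) * ((y i)⁻¹ * (hatμ y i)⁻¹) - L / μ i * (hatμ y i)⁻¹
        - fderiv ℝ hatμ y (Pi.single i 1) i * ((hatμ y i)⁻¹) ^ 2)
      + ((L - 1) * (L - 2) * ((y i) ^ 2)⁻¹ - (L / μ i) ^ 2)) ∂Q
      = L ^ 2 * ∫ y, (1 / μ i - 1 / hatμ y i) ^ 2 ∂Q := by
    intro i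
    have h1 : L - 1 ≠ 0 := by linarith
    have h2 : L - 2 ≠ 0 := by linarith
    rw [integral_add (hI2 i) (hI3 i), integral_add ((hloss_i i).const_mul _) ((hI1 i).const_mul _),
      integral_const_mul, integral_const_mul, hstein,
      integral_sub ((hYinv i).const_mul _) (integrable_const _),
      integral_const_mul, hsq, integral_const]
    simp only [probReal_univ, one_smul]
    field_simp
    ring
  have hmap : ∀ g : (Fin d → ℝ) → ℝ, Measurable g → ∫ ω, g (Y ω) ∂P = ∫ y, g y ∂Q := by
    intro g hg
    rw [← hlaw, integral_map hmeas.aemeasurable hg.aestronglyMeasurable]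
  rw [hmap (fun y => ∑ i, (1 / μ i - 1 / hatμ y i) ^ 2) (by fun_prop),
    hmap (fun y => ∑ i, (L ^ 2 / hatμ y i ^ 2 - 2 * L * (L - 1) / (y i * hatμ y i)
      + 2 * L / hatμ y i ^ 2 * fderiv ℝ hatμ y (Pi.single i 1) i
      + (L - 1) * (L - 2) / y i ^ 2)) (by fun_prop),
    integral_finsetSum _ (fun i _ => hloss_i i), Finset.mul_sum]
  simp only [← hterm]
  rw [← integral_finsetSum]
  · refine integral_congr_ae (.of_forall fun y => Finset.sum_congr rfl fun i _ => ?_)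
    simp only [div_eq_mul_inv, mul_inv, inv_pow]
    ring
  · exact fun i _ => (hI2 i).add (hI3 i)
end

section
/- (Unbiasedness of PURE) Let Y be a random vector in ℕ^d with independent entries, where Y_i follows a Poisson distribution with mean μ_i > 0. Let μ̂ : ℕ^d → ℝ^d be any map such that the expectations below are finite. Define PURE(Y) = ‖μ̂(Y)‖² − 2·∑_{i=1}^d Y_i·μ̂_i(Y − e_i) + ∑_{i=1}^d Y_i·(Y_i − 1), where e_i is the i-th standard basis vector. Then E[PURE(Y)] = E‖μ − μ̂(Y)‖². -/
open MeasureTheory ProbabilityTheory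

lemma natCast_succ_mul_poissonMeasure_singleton (r : NNReal) (n : ℕ) :
    ((n + 1 : ℕ) : ENNReal) * poissonMeasure r {n + 1} = r * poissonMeasure r {n} := by
  rw [poissonMeasure_singleton, poissonMeasure_singleton, ← ENNReal.ofReal_natCast,
    ← ENNReal.ofReal_coe_nnreal, ← ENNReal.ofReal_mul (by positivity),
    ← ENNReal.ofReal_mul (by positivity), Nat.factorial_succ]
  congr 1
  push_cast
  field_simp
  ring

/-- Size-biasing the `i`-th coordinate of a product of Poisson measures shifts it by one. -/
lemma pi_poissonMeasure_withDensity_apply {ι : Type*} [Fintype ι] [DecidableEq ι]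
    (r : ι → NNReal) (i : ι) :
    (Measure.pi fun j => poissonMeasure (r j)).withDensity (fun y => ((y i : NNReal) : ENNReal))
      = r i • (Measure.pi fun j => poissonMeasure (r j)).map (· + Pi.single i 1) := by
  refine Measure.ext_of_singleton fun y => ?_
  rw [withDensity_apply _ (measurableSet_singleton y), lintegral_singleton, Measure.smul_apply,
    Measure.map_apply .of_discrete (measurableSet_singleton y)]
  rcases Nat.eq_zero_or_pos (y i) with hy | hy
  · have : (· + Pi.single i 1) ⁻¹' {y} = (∅ : Set (ι → ℕ)) := by
      ext z
      simp only [Set.mem_preimage, Set.mem_singleton_iff, Set.mem_empty_iff_false, iff_false]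
      rintro rfl
      simp at hy
    simp [this, hy]
  · obtain ⟨z, rfl⟩ : ∃ z, y = z + Pi.single i 1 := by
      refine ⟨y - Pi.single i 1, (tsub_add_cancel_of_le fun j => ?_).symm⟩
      rcases eq_or_ne j i with rfl | hj
      · simpa using Nat.succ_le_of_lt hy
      · simp [hj]
    have : (· + Pi.single i 1) ⁻¹' {z + Pi.single i 1} = ({z} : Set (ι → ℕ)) := by
      ext w
      simp
    rw [this, Measure.pi_singleton, Measure.pi_singleton, ENNReal.smul_def, smul_eq_mul,
      ← Finset.mul_prod_erase _ _ (Finset.mem_univ i),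
      ← Finset.mul_prod_erase (f := fun j => poissonMeasure (r j) {z j}) _ (Finset.mem_univ i),
      ← mul_assoc, ← mul_assoc]
    congr 1
    · simpa using natCast_succ_mul_poissonMeasure_singleton (r i) (z i)
    · refine Finset.prod_congr rfl fun j hj => ?_
      simp [Finset.ne_of_mem_erase hj]

lemma integrable_apply_mul_sub_single_pi_poissonMeasure {ι : Type*} [Fintype ι] [DecidableEq ι]
    (r : ι → NNReal) (i : ι) {g : (ι → ℕ) → ℝ}
    (hg : Integrable g (Measure.pi fun j => poissonMeasure (r j))) :
    Integrable (fun y => (y i : ℝ) * g (y - Pi.single i 1))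
      (Measure.pi fun j => poissonMeasure (r j)) := by
  have h : Integrable (fun y => g (y - Pi.single i 1))
      ((Measure.pi fun j => poissonMeasure (r j)).withDensity
        (fun y => ((y i : NNReal) : ENNReal))) := by
    rw [pi_poissonMeasure_withDensity_apply]
    refine Integrable.smul_measure_nnreal ?_
    rw [integrable_map_measure .of_discrete .of_discrete]
    simpa [Function.comp_def] using hg
  rw [integrable_withDensity_iff_integrable_smul .of_discrete] at h
  simpa [NNReal.smul_def] using h

/-- The Chen–Stein (Hudson) identity for independent Poisson variables. -/
lemma integral_apply_mul_sub_single_pi_poissonMeasure {ι : Type*} [Fintype ι] [DecidableEq ι]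
    (r : ι → NNReal) (i : ι) (g : (ι → ℕ) → ℝ) :
    ∫ y, (y i : ℝ) * g (y - Pi.single i 1) ∂(Measure.pi fun j => poissonMeasure (r j))
      = r i * ∫ y, g y ∂(Measure.pi fun j => poissonMeasure (r j)) := by
  have h := integral_withDensity_eq_integral_smul
    (μ := Measure.pi fun j => poissonMeasure (r j)) (f := fun y => (y i : NNReal))
    .of_discrete (fun y => g (y - Pi.single i 1))
  rw [pi_poissonMeasure_withDensity_apply, integral_smul_nnreal_measure,
    integral_map .of_discrete .of_discrete] at h
  simpa [NNReal.smul_def] using h.symm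

/-- Unbiasedness of PURE, under a product of Poisson measures. -/
lemma integral_pure_pi_poissonMeasure {ι : Type*} [Fintype ι] [DecidableEq ι]
    (μ : ι → NNReal) (hatμ : (ι → ℕ) → ι → ℝ)
    (hsum : Integrable (fun y => ∑ i, ((μ i : ℝ) - hatμ y i) ^ 2)
      (Measure.pi fun i => poissonMeasure (μ i))) :
    ∫ y, ((∑ i, hatμ y i ^ 2)
        - 2 * ∑ i, (y i : ℝ) * hatμ (y - Pi.single i 1) i
        + ∑ i, (y i : ℝ) * ((y i : ℝ) - 1)) ∂(Measure.pi fun i => poissonMeasure (μ i))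
      = ∫ y, ∑ i, ((μ i : ℝ) - hatμ y i) ^ 2 ∂(Measure.pi fun i => poissonMeasure (μ i)) := by
  set π := Measure.pi fun i => poissonMeasure (μ i) with hπ
  have hsq (i : ι) : Integrable (fun y => ((μ i : ℝ) - hatμ y i) ^ 2) π := by
    refine hsum.mono' .of_discrete (.of_forall fun y => ?_)
    rw [Real.norm_of_nonneg (sq_nonneg _)]
    exact Finset.single_le_sum (f := fun j => ((μ j : ℝ) - hatμ y j) ^ 2)
      (fun j _ => sq_nonneg _) (Finset.mem_univ i)
  have hL2 (i : ι) : MemLp (fun y => hatμ y i) 2 π := by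
    have h : MemLp (fun y => (μ i : ℝ) - hatμ y i) 2 π :=
      (memLp_two_iff_integrable_sq .of_discrete).2 (hsq i)
    simpa [Pi.sub_def] using (memLp_const (μ i : ℝ)).sub h
  have hL1 (i : ι) : Integrable (fun y => hatμ y i) π := (hL2 i).integrable one_le_two
  have hhat (i : ι) : Integrable (fun y => hatμ y i ^ 2) π := (hL2 i).integrable_sq
  have hcross (i : ι) :
      Integrable (fun y => (y i : ℝ) * hatμ (y - Pi.single i 1) i) π :=
    integrable_apply_mul_sub_single_pi_poissonMeasure μ i (hL1 i)
  have hone (i : ι) : Integrable (fun y => (y i : ℝ)) π := by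
    simpa using integrable_apply_mul_sub_single_pi_poissonMeasure μ i
      (g := fun _ => 1) (integrable_const _)
  have hmean (i : ι) : ∫ y, (y i : ℝ) ∂π = μ i := by
    simpa using integral_apply_mul_sub_single_pi_poissonMeasure μ i (fun _ => 1)
  have hfactorial (i : ι) : (fun y : ι → ℕ => (y i : ℝ) * ((y i : ℝ) - 1))
      = fun y => (y i : ℝ) * (((y - Pi.single i 1 : ι → ℕ) i : ℕ) : ℝ) := by
    ext y
    rcases h : y i with _ | n <;> simp [h]
  have hquad (i : ι) : Integrable (fun y => (y i : ℝ) * ((y i : ℝ) - 1)) π := by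
    rw [hfactorial]
    exact integrable_apply_mul_sub_single_pi_poissonMeasure μ i (hone i)
  have hquadmean (i : ι) : ∫ y, (y i : ℝ) * ((y i : ℝ) - 1) ∂π = μ i * μ i := by
    rw [hfactorial, integral_apply_mul_sub_single_pi_poissonMeasure μ i (fun y => (y i : ℝ)),
      ← hπ, hmean]
  have hcrossmean (i : ι) : ∫ y, (y i : ℝ) * hatμ (y - Pi.single i 1) i ∂π
      = μ i * ∫ y, hatμ y i ∂π :=
    integral_apply_mul_sub_single_pi_poissonMeasure μ i (fun y => hatμ y i)
  have hdiff (i : ι) : Integrable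
      (fun y => hatμ y i ^ 2 - 2 * ((y i : ℝ) * hatμ (y - Pi.single i 1) i)) π :=
    (hhat i).sub ((hcross i).const_mul 2)
  have htotal (i : ι) : Integrable
      (fun y => hatμ y i ^ 2 - 2 * ((y i : ℝ) * hatμ (y - Pi.single i 1) i)
        + (y i : ℝ) * ((y i : ℝ) - 1)) π :=
    (hdiff i).add (hquad i)
  simp only [Finset.mul_sum, ← Finset.sum_sub_distrib, ← Finset.sum_add_distrib]
  rw [integral_finsetSum _ fun i _ => htotal i, integral_finsetSum _ fun i _ => hsq i]
  refine Finset.sum_congr rfl fun i _ => ?_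
  have hexpand (y : ι → ℕ) : ((μ i : ℝ) - hatμ y i) ^ 2
      = hatμ y i ^ 2 - 2 * μ i * hatμ y i + μ i * μ i := by ring
  have hlin : Integrable (fun y => hatμ y i ^ 2 - 2 * μ i * hatμ y i) π :=
    (hhat i).sub ((hL1 i).const_mul _)
  simp only [hexpand]
  rw [integral_add (hdiff i) (hquad i), integral_sub (hhat i) ((hcross i).const_mul 2),
    integral_const_mul, hcrossmean, hquadmean, integral_add hlin (integrable_const _),
    integral_sub (hhat i) ((hL1 i).const_mul _), integral_const_mul, integral_const]
  simp [mul_assoc]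

/-- Unbiasedness of PURE: for `Y` with independent Poisson entries of means
`μ_i > 0` and any `μ̂ : ℕ^d → ℝ^d` with finite expectations,
`E[‖μ̂(Y)‖² − 2 ∑ i Y_i μ̂_i(Y − e_i) + ∑ i Y_i (Y_i − 1)] = E‖μ − μ̂(Y)‖²`. -/
theorem pure_unbiased
    {Ω : Type*} [MeasurableSpace Ω] (P : Measure Ω) [IsProbabilityMeasure P]
    (d : ℕ) (μ : Fin d → NNReal) (hμ : ∀ i, 0 < μ i)
    (Y : Ω → Fin d → ℕ) (hmeas : Measurable Y)
    (hlaw : P.map Y = Measure.pi (fun i => poissonMeasure (μ i)))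
    (hatμ : (Fin d → ℕ) → (Fin d → ℝ))
    (hint1 : Integrable (fun ω =>
      (∑ i, hatμ (Y ω) i ^ 2)
        - 2 * ∑ i, (Y ω i : ℝ) * hatμ (Y ω - Pi.single i 1) i
        + ∑ i, (Y ω i : ℝ) * ((Y ω i : ℝ) - 1)) P)
    (hint2 : Integrable (fun ω => ∑ i, ((μ i : ℝ) - hatμ (Y ω) i) ^ 2) P) :
    ∫ ω, ((∑ i, hatμ (Y ω) i ^ 2)
        - 2 * ∑ i, (Y ω i : ℝ) * hatμ (Y ω - Pi.single i 1) i
        + ∑ i, (Y ω i : ℝ) * ((Y ω i : ℝ) - 1)) ∂P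
      = ∫ ω, ∑ i, ((μ i : ℝ) - hatμ (Y ω) i) ^ 2 ∂P := by
  have hsum : Integrable (fun y => ∑ i, ((μ i : ℝ) - hatμ y i) ^ 2) (P.map Y) := by
    rw [integrable_map_measure .of_discrete hmeas.aemeasurable]
    exact hint2
  rw [hlaw] at hsum
  have h := integral_pure_pi_poissonMeasure μ hatμ hsum
  rwa [← hlaw, integral_map hmeas.aemeasurable .of_discrete,
    integral_map hmeas.aemeasurable .of_discrete] at h
end

section
/- Let Y be a random vector in ℕ^d with independent entries, where Y_i follows a negative binomial distribution with probability mass function (Γ(r + y)/(y!·Γ(r)))·p_i^y·(1 − p_i)^r for y ∈ ℕ, with known shape r > 0, r ∉ {1, 2}, and unknown probability p_i ∈ (0, 1). Let p̂ : ℕ^d → ℝ^d be any map such that the expectations below are finite. Then the statistic ‖p̂(Y)‖² − 2·∑_{i=1}^d Y_i·p̂_i(Y − e_i)/(Y_i + r − 1) + ∑_{i=1}^d Y_i(Y_i − 1)/((Y_i + r − 1)(Y_i + r − 2)) is an unbiased estimator of E‖p̂(Y) − p‖², where p = (p_1, …, p_d) and e_i is the i-th standard basis vector. -/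
open MeasureTheory

/-- Shifting one count up by one multiplies the negative binomial weight by
`p * (y + r) / (y + 1)`. -/
lemma negBin_weight_succ {r : ℝ} (hr : 0 < r) (p : ℝ) (n : ℕ) :
    ((n + 1 : ℕ) : ℝ) / (((n + 1 : ℕ) : ℝ) + r - 1) *
      (Real.Gamma (r + (n + 1 : ℕ)) / ((Nat.factorial (n + 1) : ℝ) * Real.Gamma r)
          * p ^ (n + 1) * (1 - p) ^ r) =
      p * (Real.Gamma (r + n) / ((Nat.factorial n : ℝ) * Real.Gamma r)
          * p ^ n * (1 - p) ^ r) := by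
  have h : r + (n : ℝ) ≠ 0 := by positivity
  have h' : ((n : ℝ) + r) ≠ 0 := by positivity
  have hG : Real.Gamma r ≠ 0 := (Real.Gamma_pos_of_pos hr).ne'
  have hf : (Nat.factorial n : ℝ) ≠ 0 := by positivity
  have hn : (n : ℝ) + 1 ≠ 0 := by positivity
  have e : r + ((n + 1 : ℕ) : ℝ) = (r + n) + 1 := by push_cast; ring
  have e' : ((n + 1 : ℕ) : ℝ) + r - 1 = n + r := by push_cast; ring
  rw [e, e', Real.Gamma_add_one h, Nat.factorial_succ]
  push_cast
  field_simp
  ring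

lemma nat_div_add_sub_one_nonneg {r : ℝ} (hr : 0 < r) (n : ℕ) :
    0 ≤ (n : ℝ) / ((n : ℝ) + r - 1) := by
  cases n with
  | zero => simp
  | succ k =>
    have : ((k + 1 : ℕ) : ℝ) + r - 1 = k + r := by push_cast; ring
    rw [this]
    positivity

/-- For a product of negative binomial laws, shifting coordinate `i` up by one and scaling by `p i`
is the same as weighting by `y i / (y i + r - 1)`. -/
lemma negBin_smul_map_add_single {d : ℕ} {r : ℝ} (hr : 0 < r) {p : Fin d → ℝ}
    (hp : ∀ i, 0 ≤ p i) {μ : Measure (Fin d → ℕ)}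
    (hμ : ∀ y : Fin d → ℕ, μ {y} = ENNReal.ofReal (∏ i,
        Real.Gamma (r + y i) / ((Nat.factorial (y i) : ℝ) * Real.Gamma r)
          * p i ^ y i * (1 - p i) ^ r)) (i : Fin d) :
    μ.withDensity (fun y => (((y i : ℝ) / ((y i : ℝ) + r - 1)).toNNReal : ENNReal)) =
      ENNReal.ofReal (p i) • μ.map (fun y => y + Pi.single i 1) := by
  refine Measure.ext_of_singleton fun y => ?_
  rw [withDensity_apply _ (measurableSet_singleton y), lintegral_singleton, Measure.smul_apply,
    Measure.map_apply (measurable_of_countable _) (measurableSet_singleton y), smul_eq_mul]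
  rcases Nat.eq_zero_or_pos (y i) with h0 | hpos
  · have : (fun z : Fin d → ℕ => z + Pi.single i 1) ⁻¹' {y} = ∅ := by
      ext z
      simp only [Set.mem_preimage, Set.mem_singleton_iff, Set.mem_empty_iff_false, iff_false]
      rintro rfl
      simp at h0
    simp [this, h0]
  · obtain ⟨z, rfl⟩ : ∃ z : Fin d → ℕ, y = z + Pi.single i 1 := by
      refine ⟨y - Pi.single i 1, ?_⟩
      ext j
      rcases eq_or_ne j i with rfl | hj
      · simp; omega
      · simp [hj]
    have : (fun z : Fin d → ℕ => z + Pi.single i 1) ⁻¹' {z + Pi.single i 1} = {z} := by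
      ext w
      simp
    rw [this, hμ, hμ, ← ENNReal.ofReal_mul (hp i), ← ENNReal.ofReal,
      ← ENNReal.ofReal_mul (nat_div_add_sub_one_nonneg hr _)]
    congr 1
    rw [← Finset.mul_prod_erase _ _ (Finset.mem_univ i),
      ← Finset.mul_prod_erase _ _ (Finset.mem_univ i), ← mul_assoc (_ / _), ← mul_assoc (p i)]
    refine congrArg₂ _ ?_ ?_
    · simpa using negBin_weight_succ hr (p i) (z i)
    · refine Finset.prod_congr rfl fun j hj => ?_
      simp [Finset.ne_of_mem_erase hj]

/-- The Stein-type identity of the negative binomial family. -/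
lemma negBin_stein {d : ℕ} {r : ℝ} (hr : 0 < r) {p : Fin d → ℝ}
    (hp : ∀ i, 0 ≤ p i) {μ : Measure (Fin d → ℕ)}
    (hμ : ∀ y : Fin d → ℕ, μ {y} = ENNReal.ofReal (∏ i,
        Real.Gamma (r + y i) / ((Nat.factorial (y i) : ℝ) * Real.Gamma r)
          * p i ^ y i * (1 - p i) ^ r)) (i : Fin d)
    {g : (Fin d → ℕ) → ℝ} (hg : Integrable g μ) :
    Integrable (fun y => (y i : ℝ) / ((y i : ℝ) + r - 1) * g (y - Pi.single i 1)) μ ∧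
      ∫ y, (y i : ℝ) / ((y i : ℝ) + r - 1) * g (y - Pi.single i 1) ∂μ = p i * ∫ y, g y ∂μ := by
  have key := negBin_smul_map_add_single hr hp hμ i
  have hm : Measurable (fun y : Fin d → ℕ => y + Pi.single i 1) := measurable_of_countable _
  have hgm : ∀ ν : Measure (Fin d → ℕ),
      AEStronglyMeasurable (fun y => g (y - Pi.single i 1)) ν :=
    fun ν => (measurable_of_countable _).aestronglyMeasurable
  have hw : Measurable (fun y : Fin d → ℕ => ((y i : ℝ) / ((y i : ℝ) + r - 1)).toNNReal) :=
    measurable_of_countable _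
  have hsmul : ∀ y : Fin d → ℕ, ((y i : ℝ) / ((y i : ℝ) + r - 1)).toNNReal •
      g (y - Pi.single i 1) = (y i : ℝ) / ((y i : ℝ) + r - 1) * g (y - Pi.single i 1) := by
    intro y
    rw [NNReal.smul_def, Real.coe_toNNReal _ (nat_div_add_sub_one_nonneg hr _), smul_eq_mul]
  have hcomp : (fun y => g (y - Pi.single i 1)) ∘ (fun y : Fin d → ℕ => y + Pi.single i 1) = g := by
    ext y
    simp
  constructor
  · simp_rw [← hsmul]
    rw [← integrable_withDensity_iff_integrable_smul hw, key]
    refine Integrable.smul_measure ?_ ENNReal.ofReal_ne_top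
    rw [integrable_map_measure (hgm _) hm.aemeasurable, hcomp]
    exact hg
  · simp_rw [← hsmul]
    rw [← integral_withDensity_eq_integral_smul hw, key, integral_smul_measure,
      integral_map hm.aemeasurable (hgm _), ENNReal.toReal_ofReal (hp i), smul_eq_mul]
    simp

/-- for `Y` with independent negative binomial entries of shape `r > 0`
(`r ∉ {1,2}`) and probabilities `p_i ∈ (0,1)`, the negative binomial GPURE statistic
unbiasedly estimates `E‖p̂(Y) − p‖²`. -/
theorem gpure_negbin_unbiased
    {Ω : Type*} [MeasurableSpace Ω] (P : Measure Ω) [IsProbabilityMeasure P]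
    (d : ℕ) (r : ℝ) (hr : 0 < r) (hr1 : r ≠ 1) (hr2 : r ≠ 2)
    (p : Fin d → ℝ) (hp : ∀ i, p i ∈ Set.Ioo (0 : ℝ) 1)
    (Y : Ω → Fin d → ℕ) (hmeas : Measurable Y)
    (hlaw : ∀ y : Fin d → ℕ,
      P.map Y {y} = ENNReal.ofReal (∏ i,
        Real.Gamma (r + y i) / ((Nat.factorial (y i) : ℝ) * Real.Gamma r)
          * p i ^ y i * (1 - p i) ^ r))
    (hatp : (Fin d → ℕ) → (Fin d → ℝ))
    (hint1 : Integrable (fun ω =>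
      (∑ i, hatp (Y ω) i ^ 2)
        - 2 * ∑ i, (Y ω i : ℝ) * hatp (Y ω - Pi.single i 1) i / ((Y ω i : ℝ) + r - 1)
        + ∑ i, (Y ω i : ℝ) * ((Y ω i : ℝ) - 1)
            / (((Y ω i : ℝ) + r - 1) * ((Y ω i : ℝ) + r - 2))) P)
    (hint2 : Integrable (fun ω => ∑ i, (hatp (Y ω) i - p i) ^ 2) P) :
    ∫ ω, ((∑ i, hatp (Y ω) i ^ 2)
        - 2 * ∑ i, (Y ω i : ℝ) * hatp (Y ω - Pi.single i 1) i / ((Y ω i : ℝ) + r - 1)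
        + ∑ i, (Y ω i : ℝ) * ((Y ω i : ℝ) - 1)
            / (((Y ω i : ℝ) + r - 1) * ((Y ω i : ℝ) + r - 2))) ∂P
      = ∫ ω, ∑ i, (hatp (Y ω) i - p i) ^ 2 ∂P := by
  set μ := P.map Y with hμdef
  have hp0 : ∀ i, 0 ≤ p i := fun i => (hp i).1.le
  have : IsProbabilityMeasure μ := Measure.isProbabilityMeasure_map hmeas.aemeasurable
  have hasm : ∀ f : (Fin d → ℕ) → ℝ, AEStronglyMeasurable f μ :=
    fun f => (measurable_of_countable f).aestronglyMeasurable
  have hI2 : Integrable (fun y => ∑ i, (hatp y i - p i) ^ 2) μ :=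
    (integrable_map_measure (hasm _) hmeas.aemeasurable).2 hint2
  have hsq : ∀ i, Integrable (fun y => (hatp y i - p i) ^ 2) μ := fun i =>
    hI2.mono' (hasm _) (.of_forall fun y => by
      rw [Real.norm_of_nonneg (sq_nonneg _)]
      exact Finset.single_le_sum (f := fun i => (hatp y i - p i) ^ 2)
        (fun j _ => sq_nonneg _) (Finset.mem_univ i))
  have hdiff : ∀ i, Integrable (fun y => hatp y i - p i) μ := fun i =>
    ((memLp_two_iff_integrable_sq (hasm _)).2 (hsq i)).integrable one_le_two
  have hlin : ∀ i, Integrable (fun y => hatp y i) μ := fun i => by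
    refine ((hdiff i).add (integrable_const (p i))).congr (.of_forall fun y => ?_)
    simp
  have hquad : ∀ i, Integrable (fun y => hatp y i ^ 2) μ := fun i => by
    refine (((hsq i).add ((hlin i).const_mul (2 * p i))).sub
      (integrable_const (p i ^ 2))).congr (.of_forall fun y => ?_)
    simp only [Pi.add_apply, Pi.sub_apply]
    ring
  have hS := fun i => negBin_stein hr hp0 hlaw i (hlin i)
  have hS1 := fun i => negBin_stein hr hp0 hlaw i (integrable_const (1 : ℝ))
  simp only [mul_one, integral_const, probReal_univ, smul_eq_mul] at hS1
  have hS2 := fun i => negBin_stein hr hp0 hlaw i (hS1 i).1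
  have hcross : ∀ i (y : Fin d → ℕ), (y i : ℝ) * hatp (y - Pi.single i 1) i / ((y i : ℝ) + r - 1) =
      (y i : ℝ) / ((y i : ℝ) + r - 1) * hatp (y - Pi.single i 1) i := fun i y => by ring
  have hlast : ∀ i (y : Fin d → ℕ), (y i : ℝ) * ((y i : ℝ) - 1)
      / (((y i : ℝ) + r - 1) * ((y i : ℝ) + r - 2)) = (y i : ℝ) / ((y i : ℝ) + r - 1) *
        (((y - Pi.single i 1 : Fin d → ℕ) i : ℝ) /
          (((y - Pi.single i 1 : Fin d → ℕ) i : ℝ) + r - 1)) := fun i y => by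
    rcases Nat.eq_zero_or_pos (y i) with h0 | hpos
    · simp [h0]
    · have : (((y - Pi.single i 1 : Fin d → ℕ) i : ℕ) : ℝ) = (y i : ℝ) - 1 := by
        simp [Nat.cast_sub (Nat.succ_le_of_lt hpos)]
      rw [this, mul_div_mul_comm]
      congr 2
      ring
  have hA : Integrable (fun y => ∑ i, hatp y i ^ 2) μ := integrable_finsetSum _ fun i _ => hquad i
  have hB : Integrable (fun y : Fin d → ℕ => 2 * ∑ i,
      (y i : ℝ) / ((y i : ℝ) + r - 1) * hatp (y - Pi.single i 1) i) μ :=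
    (integrable_finsetSum _ fun i _ => (hS i).1).const_mul 2
  have hAB : Integrable (fun y : Fin d → ℕ => (∑ i, hatp y i ^ 2) - 2 * ∑ i,
      (y i : ℝ) / ((y i : ℝ) + r - 1) * hatp (y - Pi.single i 1) i) μ := hA.sub hB
  have hC := integrable_finsetSum Finset.univ fun i _ => (hS2 i).1
  have hmain : ∫ y, ((∑ i, hatp y i ^ 2)
        - 2 * ∑ i, (y i : ℝ) * hatp (y - Pi.single i 1) i / ((y i : ℝ) + r - 1)
        + ∑ i, (y i : ℝ) * ((y i : ℝ) - 1)
            / (((y i : ℝ) + r - 1) * ((y i : ℝ) + r - 2))) ∂μ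
      = ∫ y, ∑ i, (hatp y i - p i) ^ 2 ∂μ := by
    simp_rw [hcross, hlast]
    rw [integral_add hAB hC, integral_sub hA hB, integral_const_mul,
      integral_finsetSum _ fun i _ => hquad i, integral_finsetSum _ fun i _ => (hS i).1,
      integral_finsetSum _ fun i _ => (hS2 i).1, integral_finsetSum _ fun i _ => hsq i,
      Finset.mul_sum, ← Finset.sum_sub_distrib, ← Finset.sum_add_distrib]
    refine Finset.sum_congr rfl fun i _ => ?_
    have hexp : ∫ y, (hatp y i - p i) ^ 2 ∂μ =
        ∫ y, (hatp y i ^ 2 - 2 * p i * hatp y i + p i ^ 2) ∂μ := by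
      congr 1 with y
      ring
    have hsub : Integrable (fun y => hatp y i ^ 2 - 2 * p i * hatp y i) μ :=
      (hquad i).sub ((hlin i).const_mul _)
    rw [hexp, integral_add hsub (integrable_const _),
      integral_sub (hquad i) ((hlin i).const_mul _), integral_const_mul, (hS i).2, (hS2 i).2,
      (hS1 i).2]
    simp only [integral_const, probReal_univ, smul_eq_mul]
    ring
  rw [hμdef, integral_map hmeas.aemeasurable (hasm _),
    integral_map hmeas.aemeasurable (hasm _)] at hmain
  exact hmain
end

section
/- (Stein Unbiased KLS estimator) Let Y be a random vector in ℝ^d whose distribution P_θ has density p(y; θ) = h(y)·exp(⟨y, θ⟩ − A(θ)) with respect to Lebesgue measure on ℝ^d, where h is continuously differentiable and A is the log-partition function with invertible gradient ∇A. Let μ̂ : ℝ^d → ℝ^d be continuously differentiable with bounded partial derivatives, set θ̂(Y) = (∇A)^{-1}(μ̂(Y)), and assume the required integrability and decay-at-infinity conditions hold. Define SUKLS(Y) = ⟨θ̂(Y) + ∇h(Y)/h(Y), μ̂(Y)⟩ + tr(∂μ̂/∂y)(Y) − A(θ̂(Y)). Then E[SUKLS(Y)] = E[D(P_{θ̂(Y)}‖P_θ)]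 − A(θ), where D(P_{θ₁}‖P_{θ₀}) = A(θ₀) − A(θ₁) − ⟨∇A(θ₁), θ₀ − θ₁⟩ is the Kullback-Leibler divergence within the family. -/
open MeasureTheory Filter

/-- The divergence theorem on the whole space. -/
theorem integral_divergence_eq_zero {d : ℕ} (F : (Fin d → ℝ) → Fin d → ℝ)
    (hF : ContDiff ℝ 1 F) (g : (Fin d → ℝ) → ℝ) (hg : Integrable g)
    (hFg : ∀ y i, |F y i| ≤ (1 + ‖y‖) * g y)
    (hdiv : Integrable (fun y => ∑ i, fderiv ℝ F y (Pi.single i 1) i)) :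
    ∫ y, ∑ i, fderiv ℝ F y (Pi.single i 1) i = 0 := by
  let f : ContDiffBump (0 : Fin d → ℝ) := ⟨1, 2, one_pos, one_lt_two⟩
  have hfC : ContDiff ℝ 1 f := f.contDiff
  obtain ⟨M, hM⟩ : ∃ M, ∀ x, ‖fderiv ℝ f x‖ ≤ M :=
    (hfC.continuous_fderiv one_ne_zero).bounded_above_of_compact_support
      (f.hasCompactSupport.fderiv ℝ)
  have hM0 : 0 ≤ M := (norm_nonneg _).trans (hM 0)
  have hg0 : ∀ (y : Fin d → ℝ) (_ : Fin d), 0 ≤ g y := fun y i => by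
    have h1 := (abs_nonneg _).trans (hFg y i)
    have h2 : 0 < 1 + ‖y‖ := by positivity
    exact nonneg_of_mul_nonneg_right h1 h2
  let c : ℕ → ℝ := fun n => 1 / ((n : ℝ) + 1)
  have hc : ∀ n, 0 < c n := fun n => by positivity
  have hc0 : Tendsto c atTop (nhds 0) := tendsto_one_div_add_atTop_nhds_zero_nat
  let χ : ℕ → (Fin d → ℝ) → ℝ := fun n y => f (c n • y)
  have hχC : ∀ n, ContDiff ℝ 1 (χ n) := fun n => hfC.comp (contDiff_const_smul (c n))
  have hχd : ∀ n y, fderiv ℝ (χ n) y = c n • fderiv ℝ f (c n • y) := fun n y =>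
    fderiv_comp_smul ..
  have hχs : ∀ n, HasCompactSupport (χ n) := fun n =>
    f.hasCompactSupport.comp_smul (hc n).ne'
  have hFi : ∀ i, ContDiff ℝ 1 (fun y => F y i) := fun i => contDiff_pi.1 hF i
  have hFd : ∀ y v i, fderiv ℝ (fun y => F y i) y v = fderiv ℝ F y v i := fun y v i => by
    rw [fderiv_pi (fun i => (hFi i).differentiable one_ne_zero y)]
    rfl
  have hdc : ∀ {u : (Fin d → ℝ) → ℝ}, ContDiff ℝ 1 u → ∀ v, Continuous fun y => fderiv ℝ u y v :=
    fun hu v => (hu.continuous_fderiv one_ne_zero).clm_apply continuous_const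
  have hdχs : ∀ n v, HasCompactSupport (fun y => fderiv ℝ (χ n) y v) := fun n v =>
    (hχs n).fderiv_apply ℝ v
  have hI1 : ∀ n i, Integrable
      (fun y => χ n y * fderiv ℝ (fun y => F y i) y (Pi.single i 1)) := fun n i =>
    ((hχC n).continuous.mul (hdc (hFi i) _)).integrable_of_hasCompactSupport (hχs n).mul_right
  have hI2 : ∀ n i, Integrable (fun y => fderiv ℝ (χ n) y (Pi.single i 1) * F y i) := fun n i =>
    ((hdc (hχC n) _).mul (hFi i).continuous).integrable_of_hasCompactSupport
      (hdχs n _).mul_right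
  have hparts : ∀ n, ∫ y, χ n y * ∑ i, fderiv ℝ F y (Pi.single i 1) i
      = -∑ i, ∫ y, fderiv ℝ (χ n) y (Pi.single i 1) * F y i := fun n => by
    simp_rw [Finset.mul_sum, ← hFd]
    rw [integral_finsetSum _ (fun i _ => hI1 n i), ← Finset.sum_neg_distrib]
    refine Finset.sum_congr rfl fun i _ => ?_
    exact integral_mul_fderiv_eq_neg_fderiv_mul_of_integrable (hI2 n i) (hI1 n i)
      (((hχC n).continuous.mul (hFi i).continuous).integrable_of_hasCompactSupport
        (hχs n).mul_right)
      (fun y _ => (hχC n).differentiable one_ne_zero y)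
      (fun y _ => (hFi i).differentiable one_ne_zero y)
  have hL : Tendsto (fun n => ∫ y, χ n y * ∑ i, fderiv ℝ F y (Pi.single i 1) i) atTop
      (nhds (∫ y, ∑ i, fderiv ℝ F y (Pi.single i 1) i)) := by
    refine tendsto_integral_of_dominated_convergence _ (fun n => ?_) hdiv.norm
      (fun n => Eventually.of_forall fun y => ?_) (Eventually.of_forall fun y => ?_)
    · exact (hχC n).continuous.aestronglyMeasurable.mul hdiv.aestronglyMeasurable
    · rw [norm_mul]
      refine mul_le_of_le_one_left (norm_nonneg _) ?_
      rw [Real.norm_of_nonneg f.nonneg]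
      exact f.le_one
    · have h1 : Tendsto (fun n => χ n y) atTop (nhds (f ((0 : ℝ) • y))) :=
        (hfC.continuous.tendsto _).comp (hc0.smul_const y)
      have h2 : f ((0 : ℝ) • y) = 1 :=
        f.one_of_mem_closedBall (by simp [f])
      rw [h2] at h1
      simpa using h1.mul_const (∑ i, fderiv ℝ F y (Pi.single i 1) i)
  have hR : ∀ i, Tendsto (fun n => ∫ y, fderiv ℝ (χ n) y (Pi.single i 1) * F y i) atTop
      (nhds 0) := fun i => by
    have hb : ∀ n y, |fderiv ℝ (χ n) y (Pi.single i 1)| ≤ c n * M := fun n y => by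
      have h1 := (fderiv ℝ (χ n) y).le_opNorm (Pi.single i 1)
      rw [Pi.norm_single, norm_one, mul_one, hχd, norm_smul, Real.norm_of_nonneg (hc n).le] at h1
      rw [hχd]
      exact h1.trans (mul_le_mul_of_nonneg_left (hM _) (hc n).le)
    rw [← integral_zero (Fin d → ℝ) ℝ]
    refine tendsto_integral_of_dominated_convergence (fun y => 3 * M * g y)
      (fun n => (hI2 n i).aestronglyMeasurable) (hg.const_mul _)
      (fun n => Eventually.of_forall fun y => ?_) (Eventually.of_forall fun y => ?_)
    · rw [norm_mul, Real.norm_eq_abs, Real.norm_eq_abs]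
      by_cases hy : c n * ‖y‖ ≤ 2
      · have hc1 : c n ≤ 1 := by
          rw [div_le_one (by positivity)]
          linarith [n.cast_nonneg (α := ℝ)]
        calc _ ≤ (c n * M) * ((1 + ‖y‖) * g y) :=
              mul_le_mul (hb n y) (hFg y i) (abs_nonneg _) (mul_nonneg (hc n).le hM0)
          _ = (c n + c n * ‖y‖) * (M * g y) := by ring
          _ ≤ 3 * (M * g y) :=
              mul_le_mul_of_nonneg_right (by linarith) (mul_nonneg hM0 (hg0 y i))
          _ = _ := by ring
      · have h0 : fderiv ℝ f (c n • y) = 0 := by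
          refine image_eq_zero_of_notMem_tsupport fun hmem => hy ?_
          have h2 := tsupport_fderiv_subset ℝ hmem
          rw [f.tsupport_eq, mem_closedBall_zero_iff, norm_smul,
            Real.norm_of_nonneg (hc n).le] at h2
          exact h2
        rw [hχd, h0]
        simpa using mul_nonneg (mul_nonneg zero_le_three hM0) (hg0 y i)
    · refine squeeze_zero_norm (a := fun n => c n * M * |F y i|) (fun n => ?_) ?_
      · rw [norm_mul]
        exact mul_le_mul_of_nonneg_right (hb n y) (abs_nonneg _)
      · simpa using (hc0.mul_const M).mul_const |F y i|
  refine tendsto_nhds_unique hL ?_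
  simp_rw [hparts]
  simpa using (tendsto_finsetSum Finset.univ fun i _ => hR i).neg

/-- A map with bounded partial derivatives grows at most linearly. -/
theorem exists_abs_le_mul_one_add_norm {d : ℕ} (f : (Fin d → ℝ) → Fin d → ℝ)
    (hf : Differentiable ℝ f)
    (hbdd : ∃ C : ℝ, ∀ y i j, |fderiv ℝ f y (Pi.single j 1) i| ≤ C) :
    ∃ K : ℝ, ∀ y i, |f y i| ≤ K * (1 + ‖y‖) := by
  obtain ⟨C, hC⟩ := hbdd
  have hD : ∀ y, ‖fderiv ℝ f y‖ ≤ d * |C| := fun y => by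
    refine ContinuousLinearMap.opNorm_le_bound _ (by positivity) fun v => ?_
    refine (pi_norm_le_iff_of_nonneg (by positivity)).2 fun i => ?_
    have hv : fderiv ℝ f y v i = ∑ j, v j * fderiv ℝ f y (Pi.single j 1) i := by
      conv_lhs => rw [pi_eq_sum_univ' v]
      simp [map_sum, Finset.sum_apply]
    rw [hv]
    calc _ ≤ ∑ j, ‖v j * fderiv ℝ f y (Pi.single j 1) i‖ := norm_sum_le _ _
      _ ≤ ∑ _j : Fin d, ‖v‖ * |C| := Finset.sum_le_sum fun j _ => by
          rw [norm_mul]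
          exact mul_le_mul (norm_le_pi_norm v j) ((hC y i j).trans (le_abs_self C))
            (norm_nonneg _) (norm_nonneg _)
      _ = _ := by simp; ring
  refine ⟨d * |C| + ‖f 0‖, fun y i => ?_⟩
  have h1 := convex_univ.norm_image_sub_le_of_norm_fderiv_le (𝕜 := ℝ)
    (fun x _ => hf x) (fun x _ => hD x) (Set.mem_univ 0) (Set.mem_univ y)
  rw [sub_zero] at h1
  have h2 : ‖f y‖ ≤ ‖f y - f 0‖ + ‖f 0‖ := by simpa using norm_add_le (f y - f 0) (f 0)
  have h3 : |f y i| ≤ ‖f y‖ := norm_le_pi_norm (f y) i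
  have h4 : 0 ≤ ‖f 0‖ * ‖y‖ := by positivity
  have h5 : 0 ≤ d * |C| := by positivity
  nlinarith

/-- Stein Unbiased KLS estimator: for `Y` with density
`h(y) exp(⟨y,θ⟩ − A(θ))` w.r.t. Lebesgue measure on `ℝ^d`, `μ̂` continuously differentiable
with bounded partial derivatives and `θ̂ = (∇A)⁻¹ ∘ μ̂`, under integrability and decay
conditions, `E[SUKLS(Y)] = E[D(P_{θ̂(Y)} ‖ P_θ)] − A(θ)` where
`SUKLS(Y) = ⟨θ̂(Y) + ∇h(Y)/h(Y), μ̂(Y)⟩ + tr(∂μ̂/∂y)(Y) − A(θ̂(Y))` and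
`D(P_{θ̂(Y)} ‖ P_θ) = A(θ) − A(θ̂(Y)) − ⟨∇A(θ̂(Y)), θ − θ̂(Y)⟩`. -/
theorem sukls_unbiased
    {Ω : Type*} [MeasurableSpace Ω] (P : Measure Ω) [IsProbabilityMeasure P]
    (d : ℕ) (θ : Fin d → ℝ) (h : (Fin d → ℝ) → ℝ) (A : (Fin d → ℝ) → ℝ)
    (hpos : ∀ y, 0 ≤ h y) (hh : ContDiff ℝ 1 h) (hA : Differentiable ℝ A)
    (gradA : (Fin d → ℝ) → (Fin d → ℝ))
    (hgradA : ∀ t i, fderiv ℝ A t (Pi.single i 1) = gradA t i)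
    (hgradA_inv : Function.Bijective gradA)
    (Y : Ω → Fin d → ℝ) (hmeas : Measurable Y)
    (hlaw : P.map Y
      = volume.withDensity (fun y => ENNReal.ofReal (h y * Real.exp ((∑ i, y i * θ i) - A θ))))
    (hatμ hatθ : (Fin d → ℝ) → (Fin d → ℝ))
    (hf : ContDiff ℝ 1 hatμ)
    (hbdd : ∃ C : ℝ, ∀ y i j, |fderiv ℝ hatμ y (Pi.single j 1) i| ≤ C)
    (hlink : ∀ y, gradA (hatθ y) = hatμ y)
    (hint1 : Integrable (fun ω =>
      (∑ i, (hatθ (Y ω) i + fderiv ℝ h (Y ω) (Pi.single i 1) / h (Y ω)) * hatμ (Y ω) i)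
        + (∑ i, fderiv ℝ hatμ (Y ω) (Pi.single i 1) i) - A (hatθ (Y ω))) P)
    (hint2 : Integrable (fun ω =>
      A θ - A (hatθ (Y ω)) - ∑ i, hatμ (Y ω) i * (θ i - hatθ (Y ω) i)) P)
    (hdecay : ∀ i, Tendsto (fun y : Fin d → ℝ => h y * hatμ y i * Real.exp (∑ j, y j * θ j))
      (cocompact (Fin d → ℝ)) (nhds 0)) :
    ∫ ω, ((∑ i, (hatθ (Y ω) i + fderiv ℝ h (Y ω) (Pi.single i 1) / h (Y ω)) * hatμ (Y ω) i)
        + (∑ i, fderiv ℝ hatμ (Y ω) (Pi.single i 1) i) - A (hatθ (Y ω))) ∂P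
      = (∫ ω, (A θ - A (hatθ (Y ω)) - ∑ i, hatμ (Y ω) i * (θ i - hatθ (Y ω) i)) ∂P)
        - A θ := by
  let p : (Fin d → ℝ) → ℝ := fun y => h y * Real.exp ((∑ i, y i * θ i) - A θ)
  have hp0 : ∀ y, 0 ≤ p y := fun y => mul_nonneg (hpos y) (Real.exp_pos _).le
  have hlinC : ContDiff ℝ 1 (fun y : Fin d → ℝ => (∑ i, y i * θ i) - A θ) := by fun_prop
  have hpC : ContDiff ℝ 1 p := hh.mul hlinC.exp
  have hpm : Measurable fun y => ENNReal.ofReal (p y) :=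
    hpC.continuous.measurable.ennreal_ofReal
  have hpI : Integrable p := by
    refine ⟨hpC.continuous.aestronglyMeasurable, ?_⟩
    rw [hasFiniteIntegral_iff_ofReal (Eventually.of_forall hp0)]
    have h1 : (P.map Y) Set.univ = 1 := by
      rw [Measure.map_apply hmeas MeasurableSet.univ]
      simp
    rw [hlaw, withDensity_apply _ MeasurableSet.univ, Measure.restrict_univ] at h1
    exact h1.trans_lt ENNReal.one_lt_top
  have hh0 : ∀ y, h y = 0 → fderiv ℝ h y = 0 := fun y hy =>
    IsLocalMin.fderiv_eq_zero (Eventually.of_forall fun z => hy.trans_le (hpos z))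
  let q : (Fin d → ℝ) → ℝ := fun y =>
    ∑ i, ((fderiv ℝ h y (Pi.single i 1) / h y + θ i) * hatμ y i
      + fderiv ℝ hatμ y (Pi.single i 1) i)
  let F : (Fin d → ℝ) → Fin d → ℝ := fun y => p y • hatμ y
  have hFC : ContDiff ℝ 1 F := hpC.smul hf
  have hpd : ∀ y i, fderiv ℝ p y (Pi.single i 1)
      = p y * (fderiv ℝ h y (Pi.single i 1) / h y + θ i) := fun y i => by
    have hl : HasFDerivAt (fun y : Fin d → ℝ => (∑ i, y i * θ i) - A θ)
        (∑ i, θ i • ContinuousLinearMap.proj (R := ℝ) (φ := fun _ : Fin d => ℝ) i) y :=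
      (HasFDerivAt.fun_sum fun i _ => (hasFDerivAt_apply i y).mul_const (θ i)).sub_const _
    have h1 := ((hh.differentiable one_ne_zero y).hasFDerivAt.mul hl.exp).fderiv
    have h2 : fderiv ℝ p y (Pi.single i 1) = _ := DFunLike.congr_fun h1 _
    rw [h2]
    have h3 : (∑ j, θ j • ContinuousLinearMap.proj (R := ℝ) (φ := fun _ : Fin d => ℝ) j)
        (Pi.single i 1) = θ i := by
      simp [Pi.single_apply]
    simp only [add_apply, smul_apply, h3, smul_eq_mul, p]
    by_cases hy : h y = 0
    · simp [hy, hh0 y hy]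
    · field_simp
      ring
  have hdivF : ∀ y, ∑ i, fderiv ℝ F y (Pi.single i 1) i = p y * q y := fun y => by
    rw [Finset.mul_sum]
    refine Finset.sum_congr rfl fun i _ => ?_
    rw [fderiv_fun_smul (hpC.differentiable one_ne_zero y) (hf.differentiable one_ne_zero y)]
    simp [hpd]
    ring
  have hdc : ∀ i, Measurable fun y => fderiv ℝ h y (Pi.single i 1) := fun i =>
    ((hh.continuous_fderiv one_ne_zero).clm_apply continuous_const).measurable
  have hdμ : ∀ i, Measurable fun y => fderiv ℝ hatμ y (Pi.single i 1) i := fun i =>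
    ((continuous_apply i).comp
      ((hf.continuous_fderiv one_ne_zero).clm_apply continuous_const)).measurable
  have hμm : ∀ i, Measurable fun y => hatμ y i := fun i =>
    ((continuous_apply i).comp hf.continuous).measurable
  have hqm : Measurable q := Finset.measurable_fun_sum _ fun i _ =>
    ((((hdc i).div hh.continuous.measurable).add_const _).mul (hμm i)).add (hdμ i)
  have hdiff : ∀ ω,
      ((∑ i, (hatθ (Y ω) i + fderiv ℝ h (Y ω) (Pi.single i 1) / h (Y ω)) * hatμ (Y ω) i)
        + (∑ i, fderiv ℝ hatμ (Y ω) (Pi.single i 1) i) - A (hatθ (Y ω)))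
      - (A θ - A (hatθ (Y ω)) - ∑ i, hatμ (Y ω) i * (θ i - hatθ (Y ω) i)) + A θ
      = q (Y ω) := fun ω => by
    have h1 : q (Y ω) = (∑ i, (hatθ (Y ω) i + fderiv ℝ h (Y ω) (Pi.single i 1) / h (Y ω))
          * hatμ (Y ω) i) + (∑ i, fderiv ℝ hatμ (Y ω) (Pi.single i 1) i)
        + ∑ i, hatμ (Y ω) i * (θ i - hatθ (Y ω) i) := by
      rw [← Finset.sum_add_distrib, ← Finset.sum_add_distrib]
      exact Finset.sum_congr rfl fun i _ => by ring
    rw [h1]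
    ring
  have hqI : Integrable (fun ω => q (Y ω)) P := by
    simp_rw [← hdiff]
    exact (hint1.sub hint2).add (integrable_const _)
  have htoReal : ∀ y, (ENNReal.ofReal (p y)).toReal = p y := fun y =>
    ENNReal.toReal_ofReal (hp0 y)
  have hpqI : Integrable (fun y => p y * q y) := by
    have h1 : Integrable q (P.map Y) :=
      (integrable_map_measure hqm.aestronglyMeasurable hmeas.aemeasurable).2 hqI
    rw [hlaw, integrable_withDensity_iff_integrable_smul' hpm
      (Eventually.of_forall fun _ => ENNReal.ofReal_lt_top)] at h1
    simpa only [htoReal, smul_eq_mul] using h1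
  obtain ⟨K, hK⟩ := exists_abs_le_mul_one_add_norm hatμ (hf.differentiable one_ne_zero) hbdd
  have hzero : ∫ y, p y * q y = 0 := by
    simp_rw [← hdivF] at hpqI ⊢
    refine integral_divergence_eq_zero F hFC (fun y => K * p y) (hpI.const_mul K)
      (fun y i => ?_) hpqI
    calc |F y i| = p y * |hatμ y i| := by simp [F, abs_mul, abs_of_nonneg (hp0 y)]
      _ ≤ p y * (K * (1 + ‖y‖)) := mul_le_mul_of_nonneg_left (hK y i) (hp0 y)
      _ = _ := by ring
  have hqzero : ∫ ω, q (Y ω) ∂P = 0 := by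
    rw [← integral_map hmeas.aemeasurable hqm.aestronglyMeasurable, hlaw,
      integral_withDensity_eq_integral_toReal_smul hpm
        (Eventually.of_forall fun _ => ENNReal.ofReal_lt_top)]
    simpa only [htoReal, smul_eq_mul] using hzero
  have hsplit := (integral_add (hint1.sub hint2) (integrable_const (A θ))).symm.trans
    ((integral_congr_ae (Eventually.of_forall hdiff)).trans hqzero)
  rw [integral_sub' hint1 hint2] at hsplit
  simp only [integral_const, probReal_univ, one_smul] at hsplit
  linarith
end
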